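/- In U = U_q(A(0,2)^{(4)})^+: (i) for all m, n ≥ 1, L̃_{2m} and L̃_{2n} commute: L̃_{2m}L̃_{2n} = L̃_{2n}L̃_{2m}; (ii) for every k ≥ 1, L̄_{4k}L₁ = L₁L̄_{4k}, and for every k ≥ 0, L̄_{4k+2}L₁ − L₁L̄_{4k+2} = (1/2^{2k})·([2k+1]_q/(2k+1))·M_{4k+3}, where [m]_q = (q^m − q^{−m})/(q − q⁻¹). -/

import Mathlib

noncomputable section

namespace QAff

abbrev F : Type := FreeAlgebra ℂ (Fin 2)

def x1 : F := FreeAlgebra.ι ℂ 0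
def x2 : F := FreeAlgebra.ι ℂ 1

def θ (q : ℂ) : ℂ := q - q⁻¹

def L1F (q : ℂ) : F := x1 * x2 - q⁻¹ • (x2 * x1)

def X2F (q : ℂ) : F := x1 * L1F q - L1F q * x1

def Y2F (q : ℂ) : F := L1F q * x2 + x2 * L1F q

/-- the quantum Serre relator `[x₁,[x₁,[x₁,x₂]]]` (braided brackets w.r.t. the bicharacter
`χ((a,b),(c,d)) = (-1)^(bd) q^(ac-ad-bc+bd)`). -/
def serre1 (q : ℂ) : F := x1 * X2F q - q • (X2F q * x1)

/-- the quantum Serre relator `[[[x₁,x₂],x₂],x₂]` (braided brackets). -/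
def serre2 (q : ℂ) : F := Y2F q * x2 - q • (x2 * Y2F q)

inductive Rel (q : ℂ) : F → F → Prop
  | one : Rel q (serre1 q) 0
  | two : Rel q (serre2 q) 0

/-- `U = U_q(A(0,2)^{(4)})^+`, the free algebra on `x₁, x₂` modulo the two-sided ideal
generated by the quantum Serre relators. -/
abbrev U (q : ℂ) : Type := RingQuot (Rel q)

def π (q : ℂ) : F →ₐ[ℂ] U q := RingQuot.mkAlgHom ℂ (Rel q)

/-- `L₁ = [X₁,Y₁] = x₁x₂ - q⁻¹ x₂x₁` in `U`. -/
def L1U (q : ℂ) : U q := π q x1 * π q x2 - q⁻¹ • (π q x2 * π q x1)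

/-- real root vectors `X_n`, `n ≥ 1` (`X 0 := 0` is junk):
`X₁ = x₁`, `X_{n+1} = [X_n, L₁] = X_n L₁ - (-1)^(n-1) L₁ X_n`
(the braiding scalar is `χ((n,n-1),(1,1)) = (-1)^(n-1)`). -/
def X (q : ℂ) : ℕ → U q
  | 0 => 0
  | 1 => π q x1
  | (n+2) => X q (n+1) * L1U q - ((-1 : ℂ)^n) • (L1U q * X q (n+1))

/-- real root vectors `Y_n`, `n ≥ 1` (`Y 0 := 0` is junk):
`Y₁ = x₂`, `Y_{n+1} = [L₁, Y_n] = L₁ Y_n - (-1)^n Y_n L₁`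
(the braiding scalar is `χ((1,1),(n-1,n)) = (-1)^n`). -/
def Y (q : ℂ) : ℕ → U q
  | 0 => 0
  | 1 => π q x2
  | (n+2) => L1U q * Y q (n+1) - ((-1 : ℂ)^(n+1)) • (Y q (n+1) * L1U q)

/-- `L₀ = θ⁻¹·1`, and `L_n = [X₁, Y_n] = X₁Y_n - q⁻¹ Y_n X₁` for `n ≥ 1`
(the braiding scalar is `χ((1,0),(n-1,n)) = q⁻¹`). -/
def L (q : ℂ) : ℕ → U q
  | 0 => (θ q)⁻¹ • 1
  | (n+1) => X q 1 * Y q (n+1) - q⁻¹ • (Y q (n+1) * X q 1)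

/-- `L₀′ = θ⁻¹·1`, `L₁′ = L₁`, and
`L_n′ = [X₂, Y_{n-1}] = X₂Y_{n-1} - (-1)^(n-1) q⁻¹ Y_{n-1}X₂` for `n ≥ 2`
(the braiding scalar is `χ((2,1),(n-2,n-1)) = (-1)^(n-1) q⁻¹`). -/
def L' (q : ℂ) : ℕ → U q
  | 0 => (θ q)⁻¹ • 1
  | 1 => L q 1
  | (n+2) => X q 2 * Y q (n+1) - ((-1 : ℂ)^(n+1) * q⁻¹) • (Y q (n+1) * X q 2)

/-- `M q n` is the element `M_{2n+1}`:  `M₁ = L₁`, `M_{2n+1} = [L₂, M_{2n-1}]`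
(a plain commutator, the braiding scalar being `1`). -/
def M (q : ℂ) : ℕ → U q
  | 0 => L q 1
  | (n+1) => L q 2 * M q n - M q n * L q 2

/-- `L̃_n = (L_n + L_n′)/2`, with the convention `L̃_n = 0` for `n < 0`
(note `L̃₀ = θ⁻¹·1`). -/
def Lt (q : ℂ) (n : ℤ) : U q :=
  if 0 ≤ n then ((2 : ℂ)⁻¹) • (L q n.toNat + L' q n.toNat) else 0

/-- `L̂_{n+1} = [L_n, L₁] = L_n L₁ - (-1)^n L₁ L_n`
(the braiding scalar is `χ((n,n),(1,1)) = (-1)^n`); in particular `L̂₁ = 0`. -/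
def Lhat (q : ℂ) : ℕ → U q
  | 0 => 0
  | (n+1) => L q n * L q 1 - ((-1 : ℂ)^n) • (L q 1 * L q n)

/-- the sequence `P₀ = 1`, `P_n = q^n + q^(n-1) + (-1)^(n-1) P_(n-1)`. -/
def P (q : ℂ) : ℕ → ℂ
  | 0 => 1
  | (n+1) => q^(n+1) + q^n + (-1 : ℂ)^n * P q n

/-- the sequence `Q₀ = 1`, `Q_n = q^n - q^(n-1) + (-1)^n Q_(n-1)`. -/
def Q (q : ℂ) : ℕ → ℂ
  | 0 => 1
  | (n+1) => q^(n+1) - q^n + (-1 : ℂ)^(n+1) * Q q n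

/-- `q` is not a root of unity. -/
def NotRootOfUnity (q : ℂ) : Prop := ∀ n : ℕ, n ≠ 0 → q ^ n ≠ 1

end QAff

set_option linter.unusedSimpArgs false
set_option linter.unnecessarySeqFocus false
set_option linter.unusedVariables false
set_option linter.unusedSectionVars false

/-- Real root vectors `Xo i = X_{2i+1}`, `Xe i = X_{2i+2}`, `Yo i = Y_{2i+1}`, `Ye i = Y_{2i+2}` in
an algebra with generators `Xo 0` and `Yo 0` satisfying the quantum Serre relations. -/
structure AltData (A : Type*) [Ring A] [Algebra ℂ A] (q : ℂ) where
  Xo : ℕ → A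
  Xe : ℕ → A
  Yo : ℕ → A
  Ye : ℕ → A
  L : A
  q_ne : q ≠ 0
  Xe_eq : ∀ i, Xe i = Xo i * L - L * Xo i
  Xo_succ : ∀ i, Xo (i + 1) = Xe i * L + L * Xe i
  Ye_eq : ∀ i, Ye i = L * Yo i + Yo i * L
  Yo_succ : ∀ i, Yo (i + 1) = L * Ye i - Ye i * L
  L_eq : L = Xo 0 * Yo 0 - q⁻¹ • (Yo 0 * Xo 0)
  serreX : Xo 0 * Xe 0 = q • (Xe 0 * Xo 0)
  serreY : Ye 0 * Yo 0 = q • (Yo 0 * Ye 0)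

namespace AltData

variable {A : Type*} [Ring A] [Algebra ℂ A] {q : ℂ} (d : AltData A q)

def Too (i j : ℕ) : A := d.Xo i * d.Yo j - q⁻¹ • (d.Yo j * d.Xo i)
def Toe (i j : ℕ) : A := d.Xo i * d.Ye j - q⁻¹ • (d.Ye j * d.Xo i)
def Teo (i j : ℕ) : A := d.Xe i * d.Yo j + q⁻¹ • (d.Yo j * d.Xe i)
def Tee (i j : ℕ) : A := d.Xe i * d.Ye j - q⁻¹ • (d.Ye j * d.Xe i)

lemma Too_zero : d.Too 0 0 = d.L := d.L_eq.symm

lemma Too_L (i j : ℕ) : d.Too i j * d.L + d.L * d.Too i j = d.Toe i j - d.Teo i j := by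
  simp only [Too, Toe, Teo, d.Xe_eq, d.Ye_eq, mul_add, add_mul, mul_sub, sub_mul, smul_mul_assoc,
    mul_smul_comm, mul_assoc, smul_add, smul_sub]
  module

lemma Toe_L (i j : ℕ) : d.Toe i j * d.L - d.L * d.Toe i j = d.Tee i j - d.Too i (j + 1) := by
  simp only [Too, Toe, Tee, d.Xe_eq, d.Yo_succ, mul_add, add_mul, mul_sub, sub_mul, smul_mul_assoc,
    mul_smul_comm, mul_assoc, smul_add, smul_sub]
  module

lemma Teo_L (i j : ℕ) : d.Teo i j * d.L - d.L * d.Teo i j = d.Tee i j - d.Too (i + 1) j := by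
  simp only [Too, Teo, Tee, d.Xo_succ, d.Ye_eq, mul_add, add_mul, mul_sub, sub_mul, smul_mul_assoc,
    mul_smul_comm, mul_assoc, smul_add, smul_sub]
  module

/-- commutator with `L²`. -/
def ad2 (u : A) : A := u * (d.L * d.L) - d.L * d.L * u

/-- half the sum of the two even root vectors of lowest degree. -/
def f1 : A := (2 : ℂ)⁻¹ • (d.Toe 0 0 + d.Teo 0 0)

lemma exch_X_Teo (b : ℕ) : d.Xo 0 * d.Teo 0 b - d.Teo 0 b * d.Xo 0
    = q • (d.Xe 0 * d.Too 0 b) + q⁻¹ • (d.Too 0 b * d.Xe 0) := by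
  have h1 := congrArg (· * d.Yo b) d.serreX
  have h2 := congrArg (d.Yo b * ·) d.serreX
  have hq := d.q_ne
  simp only [smul_mul_assoc, mul_smul_comm, mul_assoc] at h1 h2
  simp only [Too, Teo, mul_add, add_mul, mul_sub, sub_mul, smul_mul_assoc,
    mul_smul_comm, mul_assoc, smul_add, smul_sub, h1, h2]
  match_scalars <;> field_simp

lemma exch_X_Tee (b : ℕ) : d.Xo 0 * d.Tee 0 b - d.Tee 0 b * d.Xo 0
    = q • (d.Xe 0 * d.Toe 0 b) - q⁻¹ • (d.Toe 0 b * d.Xe 0) := by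
  have h1 := congrArg (· * d.Ye b) d.serreX
  have h2 := congrArg (d.Ye b * ·) d.serreX
  have hq := d.q_ne
  simp only [smul_mul_assoc, mul_smul_comm, mul_assoc] at h1 h2
  simp only [Toe, Tee, mul_add, add_mul, mul_sub, sub_mul, smul_mul_assoc,
    mul_smul_comm, mul_assoc, smul_add, smul_sub, h1, h2]
  match_scalars <;> field_simp

lemma exch_Toe_Y (a : ℕ) : d.Toe a 0 * d.Yo 0 - d.Yo 0 * d.Toe a 0
    = q • (d.Too a 0 * d.Ye 0) - q⁻¹ • (d.Ye 0 * d.Too a 0) := by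
  have h1 := congrArg (· * d.Xo a) d.serreY
  have h2 := congrArg (d.Xo a * ·) d.serreY
  have hq := d.q_ne
  simp only [smul_mul_assoc, mul_smul_comm, mul_assoc] at h1 h2
  simp only [Toe, Too, mul_add, add_mul, mul_sub, sub_mul, smul_mul_assoc,
    mul_smul_comm, mul_assoc, smul_add, smul_sub, h1, h2]
  match_scalars <;> field_simp

lemma exch_Tee_Y (a : ℕ) : d.Tee a 0 * d.Yo 0 + d.Yo 0 * d.Tee a 0
    = q • (d.Teo a 0 * d.Ye 0) - q⁻¹ • (d.Ye 0 * d.Teo a 0) := by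
  have h1 := congrArg (· * d.Xe a) d.serreY
  have h2 := congrArg (d.Xe a * ·) d.serreY
  have hq := d.q_ne
  simp only [smul_mul_assoc, mul_smul_comm, mul_assoc] at h1 h2
  simp only [Tee, Teo, mul_add, add_mul, mul_sub, sub_mul, smul_mul_assoc,
    mul_smul_comm, mul_assoc, smul_add, smul_sub, h1, h2]
  match_scalars <;> field_simp

end AltData

namespace AltData

variable {A : Type*} [Ring A] [Algebra ℂ A] {q : ℂ} (d : AltData A q)

lemma Toe_zero : d.Toe 0 0 = d.f1 + d.L * d.L := by
  have h := d.Too_L 0 0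
  rw [d.Too_zero] at h
  rw [f1, eq_add_of_sub_eq h.symm]
  module

lemma Teo_zero : d.Teo 0 0 = d.f1 - d.L * d.L := by
  have h := d.Too_L 0 0
  rw [d.Too_zero] at h
  rw [f1, eq_add_of_sub_eq h.symm]
  module

lemma f1_Xo_zero : d.Xo 0 * d.f1 - d.f1 * d.Xo 0
    = (1 + q⁻¹) • d.Xo 1 + (q - q⁻¹) • (d.Xe 0 * d.L) := by
  have h := d.exch_X_Teo 0
  rw [d.Teo_zero, d.Too_zero] at h
  have hq := d.q_ne
  linear_combination (norm := skip) h
  simp only [zero_add, d.Xo_succ 0, d.Xe_eq, mul_add, add_mul, mul_sub, sub_mul, smul_mul_assoc,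
    mul_smul_comm, mul_assoc, smul_add, smul_sub]
  match_scalars <;> field_simp <;> ring

lemma f1_Yo_zero : d.Yo 0 * d.f1 - d.f1 * d.Yo 0
    = (1 - q) • d.Yo 1 - (q - q⁻¹) • (d.Ye 0 * d.L) := by
  have h := d.exch_Toe_Y 0
  rw [d.Toe_zero, d.Too_zero] at h
  have hq := d.q_ne
  linear_combination (norm := skip) -h
  simp only [zero_add, d.Yo_succ 0, d.Ye_eq, mul_add, add_mul, mul_sub, sub_mul, smul_mul_assoc,
    mul_smul_comm, mul_assoc, smul_add, smul_sub]
  match_scalars <;> field_simp <;> ring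

lemma f1_Too {i j : ℕ}
    (hX : d.Xo i * d.f1 - d.f1 * d.Xo i = (1 + q⁻¹) • d.Xo (i + 1) + (q - q⁻¹) • (d.Xe i * d.L))
    (hY : d.Yo j * d.f1 - d.f1 * d.Yo j = (1 - q) • d.Yo (j + 1) - (q - q⁻¹) • (d.Ye j * d.L)) :
    d.Too i j * d.f1 - d.f1 * d.Too i j = (1 + q⁻¹) • d.Too (i + 1) j + (1 - q) • d.Too i (j + 1)
      + (q - q⁻¹) • d.Tee i j - (q - q⁻¹) • ((d.Teo i j + d.Toe i j) * d.L) := by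
  have hq := d.q_ne
  rw [sub_eq_iff_eq_add'] at hX hY
  have hX' := fun z => congrArg (· * z) hX
  have hY' := fun z => congrArg (· * z) hY
  simp only [mul_assoc] at hX' hY'
  simp only [Too, Toe, Tee, Teo, mul_add, add_mul, mul_sub, sub_mul, smul_mul_assoc,
    mul_smul_comm, mul_assoc, smul_add, smul_sub, hX, hY, hX', hY', d.Xo_succ, d.Yo_succ, d.Xe_eq,
    d.Ye_eq]
  match_scalars <;> field_simp <;> ring

lemma f1_Toe {i j : ℕ}
    (hX : d.Xo i * d.f1 - d.f1 * d.Xo i = (1 + q⁻¹) • d.Xo (i + 1) + (q - q⁻¹) • (d.Xe i * d.L))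
    (hY : d.Ye j * d.f1 - d.f1 * d.Ye j
      = -(1 + q) • d.Ye (j + 1) + (q - q⁻¹) • (d.Yo (j + 1) * d.L)) :
    d.Toe i j * d.f1 - d.f1 * d.Toe i j
      = (1 + q⁻¹) • d.Toe (i + 1) j - (1 + q) • d.Toe i (j + 1)
      + (q - q⁻¹) • d.Teo i (j + 1) + (q - q⁻¹) • ((d.Tee i j + d.Too i (j + 1)) * d.L) := by
  have hq := d.q_ne
  rw [sub_eq_iff_eq_add'] at hX hY
  have hX' := fun z => congrArg (· * z) hX
  have hY' := fun z => congrArg (· * z) hY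
  simp only [mul_assoc] at hX' hY'
  simp only [Too, Toe, Tee, Teo, mul_add, add_mul, mul_sub, sub_mul, smul_mul_assoc,
    mul_smul_comm, mul_assoc, smul_add, smul_sub, hX, hY, hX', hY', d.Xo_succ, d.Xe_eq,
    d.Ye_eq (j + 1)]
  simp only [d.Yo_succ, mul_add, add_mul, mul_sub, sub_mul, smul_mul_assoc,
    mul_smul_comm, mul_assoc, smul_add, smul_sub]
  match_scalars <;> field_simp <;> ring

lemma f1_Teo {i j : ℕ}
    (hX : d.Xe i * d.f1 - d.f1 * d.Xe i
      = (q⁻¹ - 1) • d.Xe (i + 1) + (q - q⁻¹) • (d.Xo (i + 1) * d.L))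
    (hY : d.Yo j * d.f1 - d.f1 * d.Yo j = (1 - q) • d.Yo (j + 1) - (q - q⁻¹) • (d.Ye j * d.L)) :
    d.Teo i j * d.f1 - d.f1 * d.Teo i j
      = (q⁻¹ - 1) • d.Teo (i + 1) j + (1 - q) • d.Teo i (j + 1)
      + (q - q⁻¹) • d.Toe (i + 1) j - (q - q⁻¹) • ((d.Too (i + 1) j + d.Tee i j) * d.L) := by
  have hq := d.q_ne
  rw [sub_eq_iff_eq_add'] at hX hY
  have hX' := fun z => congrArg (· * z) hX
  have hY' := fun z => congrArg (· * z) hY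
  simp only [mul_assoc] at hX' hY'
  simp only [Too, Toe, Tee, Teo, mul_add, add_mul, mul_sub, sub_mul, smul_mul_assoc,
    mul_smul_comm, mul_assoc, smul_add, smul_sub, hX, hY, hX', hY', d.Yo_succ, d.Ye_eq,
    d.Xe_eq (i + 1)]
  simp only [d.Xo_succ, mul_add, add_mul, mul_sub, sub_mul, smul_mul_assoc,
    mul_smul_comm, mul_assoc, smul_add, smul_sub]
  match_scalars <;> field_simp <;> ring

lemma f1_Tee {i j : ℕ}
    (hX : d.Xe i * d.f1 - d.f1 * d.Xe i
      = (q⁻¹ - 1) • d.Xe (i + 1) + (q - q⁻¹) • (d.Xo (i + 1) * d.L))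
    (hY : d.Ye j * d.f1 - d.f1 * d.Ye j
      = -(1 + q) • d.Ye (j + 1) + (q - q⁻¹) • (d.Yo (j + 1) * d.L)) :
    d.Tee i j * d.f1 - d.f1 * d.Tee i j
      = (q⁻¹ - 1) • d.Tee (i + 1) j - (1 + q) • d.Tee i (j + 1)
      + (q - q⁻¹) • d.Too (i + 1) (j + 1)
      + (q - q⁻¹) • ((d.Toe (i + 1) j + d.Teo i (j + 1)) * d.L) := by
  have hq := d.q_ne
  rw [sub_eq_iff_eq_add'] at hX hY
  have hX' := fun z => congrArg (· * z) hX
  have hY' := fun z => congrArg (· * z) hY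
  simp only [mul_assoc] at hX' hY'
  simp only [Too, Toe, Tee, Teo, mul_add, add_mul, mul_sub, sub_mul, smul_mul_assoc,
    mul_smul_comm, mul_assoc, smul_add, smul_sub, hX, hY, hX', hY', d.Ye_eq (j + 1),
    d.Xe_eq (i + 1)]
  simp only [d.Xo_succ, d.Yo_succ, mul_add, add_mul, mul_sub, sub_mul, smul_mul_assoc,
    mul_smul_comm, mul_assoc, smul_add, smul_sub]
  match_scalars <;> field_simp <;> ring

lemma Too_one_zero : d.Too 1 0 = d.Too 0 1 := by
  have h1 := d.Toe_L 0 0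
  have h2 := d.Teo_L 0 0
  rw [d.Toe_zero] at h1
  rw [d.Teo_zero] at h2
  have : d.Too 1 0 - d.Too 0 1 = 0 := by
    linear_combination (norm := skip) h2 - h1
    simp only [zero_add, mul_add, add_mul, mul_sub, sub_mul, mul_assoc]
    abel_nf
  exact sub_eq_zero.mp this

lemma Tee_zero : d.Tee 0 0
    = ((1 + (q - q⁻¹)) / 2) • (d.f1 * d.L) - ((1 - (q - q⁻¹)) / 2) • (d.L * d.f1) := by
  have h1 := d.Toe_L 0 0
  have h2 := d.f1_Too d.f1_Xo_zero d.f1_Yo_zero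
  simp only [zero_add, d.Toe_zero, d.Teo_zero, d.Too_zero, d.Too_one_zero] at h1 h2
  have h1' : d.Too 0 1 = d.Tee 0 0 - (d.f1 * d.L - d.L * d.f1) := by
    linear_combination (norm := skip) h1
    simp only [zero_add, mul_add, add_mul, mul_sub, sub_mul, mul_assoc]
    abel
  rw [h1'] at h2
  have hq := d.q_ne
  linear_combination (norm := skip) (-1 / 2 : ℂ) • h2
  simp only [mul_add, add_mul, mul_sub, sub_mul, mul_assoc, smul_add, smul_sub]
  match_scalars <;> field_simp <;> ring

lemma f1_Xe_zero (hκ : q + q⁻¹ + 1 ≠ 0) : d.Xe 0 * d.f1 - d.f1 * d.Xe 0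
    = (q⁻¹ - 1) • d.Xe 1 + (q - q⁻¹) • (d.Xo 1 * d.L) := by
  have hq := d.q_ne
  have hX := d.f1_Xo_zero
  have h := d.exch_X_Tee 0
  rw [d.Tee_zero, d.Toe_zero] at h
  rw [sub_eq_iff_eq_add'] at hX
  have hX' := fun z => congrArg (· * z) hX
  simp only [mul_assoc] at hX'
  have hL : d.Xo 0 * d.L = d.L * d.Xo 0 + d.Xe 0 := by rw [d.Xe_eq]; abel
  have hL' : ∀ z, d.Xo 0 * (d.L * z) = d.L * (d.Xo 0 * z) + d.Xe 0 * z := fun z => by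
    rw [d.Xe_eq]; noncomm_ring
  rw [← sub_eq_zero]
  refine (smul_eq_zero.mp (?_ : (q + q⁻¹ + 1) • (_ : A) = 0)).resolve_left hκ
  linear_combination (norm := skip) (-2 : ℂ) • h
  simp only [mul_add, add_mul, mul_sub, sub_mul, smul_mul_assoc, d.Xe_eq 1,
    mul_smul_comm, mul_assoc, smul_add, smul_sub, hX, hX', hL, hL', zero_add, d.Xo_succ 0]
  match_scalars <;> field_simp <;> ring

lemma f1_Ye_zero (hκ : q + q⁻¹ - 1 ≠ 0) : d.Ye 0 * d.f1 - d.f1 * d.Ye 0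
    = -(1 + q) • d.Ye 1 + (q - q⁻¹) • (d.Yo 1 * d.L) := by
  have hq := d.q_ne
  have hX := d.f1_Yo_zero
  have h := d.exch_Tee_Y 0
  rw [d.Tee_zero, d.Teo_zero] at h
  rw [sub_eq_iff_eq_add'] at hX
  have hX' := fun z => congrArg (· * z) hX
  simp only [mul_assoc] at hX'
  have hL : d.Yo 0 * d.L = d.Ye 0 - d.L * d.Yo 0 := by rw [d.Ye_eq]; abel
  have hL' : ∀ z, d.Yo 0 * (d.L * z) = d.Ye 0 * z - d.L * (d.Yo 0 * z) := fun z => by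
    rw [d.Ye_eq]; noncomm_ring
  rw [← sub_eq_zero]
  refine (smul_eq_zero.mp (?_ : (q + q⁻¹ - 1) • (_ : A) = 0)).resolve_left hκ
  linear_combination (norm := skip) (2 : ℂ) • h
  simp only [mul_add, add_mul, mul_sub, sub_mul, smul_mul_assoc, d.Ye_eq 1,
    mul_smul_comm, mul_assoc, smul_add, smul_sub, hX, hX', hL, hL', zero_add, d.Yo_succ 0]
  match_scalars <;> field_simp <;> ring

end AltData

namespace AltData

variable {A : Type*} [Ring A] [Algebra ℂ A] {q : ℂ} (d : AltData A q)

lemma Xo_shift (i : ℕ) : d.Xo (i + 1) = d.ad2 (d.Xo i) := by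
  rw [d.Xo_succ, d.Xe_eq, ad2]; noncomm_ring

lemma Xe_shift (i : ℕ) : d.Xe (i + 1) = d.ad2 (d.Xe i) := by
  rw [d.Xe_eq, d.Xo_succ, ad2]; noncomm_ring

lemma Yo_shift (i : ℕ) : d.Yo (i + 1) = -d.ad2 (d.Yo i) := by
  rw [d.Yo_succ, d.Ye_eq, ad2]; noncomm_ring

lemma Ye_shift (i : ℕ) : d.Ye (i + 1) = -d.ad2 (d.Ye i) := by
  rw [d.Ye_eq, d.Yo_succ, ad2]; noncomm_ring

lemma ad2_mul (u v : A) : d.ad2 (u * v) = d.ad2 u * v + u * d.ad2 v := by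
  rw [ad2, ad2, ad2]; noncomm_ring

lemma ad2_add (u v : A) : d.ad2 (u + v) = d.ad2 u + d.ad2 v := by
  rw [ad2, ad2, ad2]; noncomm_ring

lemma ad2_sub (u v : A) : d.ad2 (u - v) = d.ad2 u - d.ad2 v := by
  rw [ad2, ad2, ad2]; noncomm_ring

lemma ad2_smul (c : ℂ) (u : A) : d.ad2 (c • u) = c • d.ad2 u := by
  rw [ad2, ad2, smul_mul_assoc, mul_smul_comm, smul_sub]

lemma ad2_L : d.ad2 d.L = 0 := by
  rw [ad2]; noncomm_ring

lemma ad2_Too (i j : ℕ) : d.ad2 (d.Too i j) = d.Too (i + 1) j - d.Too i (j + 1) := by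
  simp only [Too, ad2_sub, ad2_smul, ad2_mul, Xo_shift, Yo_shift, smul_add, mul_neg, neg_mul]
  module

lemma ad2_Toe (i j : ℕ) : d.ad2 (d.Toe i j) = d.Toe (i + 1) j - d.Toe i (j + 1) := by
  simp only [Toe, ad2_sub, ad2_smul, ad2_mul, Xo_shift, Ye_shift, smul_add, mul_neg, neg_mul]
  module

lemma ad2_Teo (i j : ℕ) : d.ad2 (d.Teo i j) = d.Teo (i + 1) j - d.Teo i (j + 1) := by
  simp only [Teo, ad2_add, ad2_smul, ad2_mul, Xe_shift, Yo_shift, smul_add, mul_neg, neg_mul]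
  module

lemma ad2_Tee (i j : ℕ) : d.ad2 (d.Tee i j) = d.Tee (i + 1) j - d.Tee i (j + 1) := by
  simp only [Tee, ad2_sub, ad2_smul, ad2_mul, Xe_shift, Ye_shift, smul_add, mul_neg, neg_mul]
  module

/-- The genericity conditions on `q` used below. -/
structure Generic (q : ℂ) : Prop where
  ne_zero : q ≠ 0
  pow_ne : ∀ n : ℕ, n ≠ 0 → q ^ n ≠ 1

lemma Generic.theta_ne (g : Generic q) : q - q⁻¹ ≠ 0 := by
  intro h
  have hq := g.ne_zero
  field_simp at h
  exact g.pow_ne 2 (by norm_num) (by linear_combination h)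

lemma Generic.two_ne (g : Generic q) : q + q⁻¹ ≠ 0 := by
  intro h
  have hq := g.ne_zero
  field_simp at h
  exact g.pow_ne 4 (by norm_num) (by linear_combination (q ^ 2 - 1) * h)

lemma Generic.p_ne (g : Generic q) : q + q⁻¹ + 1 ≠ 0 := by
  intro h
  have hq := g.ne_zero
  field_simp at h
  exact g.pow_ne 3 (by norm_num) (by linear_combination (q - 1) * h)

lemma Generic.m_ne (g : Generic q) : q + q⁻¹ - 1 ≠ 0 := by
  intro h
  have hq := g.ne_zero
  field_simp at h
  exact g.pow_ne 6 (by norm_num) (by linear_combination (q ^ 3 - 1) * (q + 1) * h)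

variable (g : Generic q)
include g

lemma ad2_f1 : d.ad2 d.f1 = 0 := by
  have h1 := d.f1_Toe (i := 0) (j := 0) d.f1_Xo_zero (d.f1_Ye_zero g.m_ne)
  have h2 := d.f1_Teo (i := 0) (j := 0) (d.f1_Xe_zero g.p_ne) d.f1_Yo_zero
  have h3 := d.ad2_Toe 0 0
  have h4 := d.ad2_Teo 0 0
  simp only [zero_add, Toe_zero, Teo_zero, ad2_add, ad2_sub, ad2_mul, ad2_L, Too_one_zero,
    zero_mul, mul_zero, add_zero, sub_zero] at h1 h2 h3 h4
  refine (smul_eq_zero.mp (?_ : (q + q⁻¹) • (_ : A) = 0)).resolve_left g.two_ne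
  have hq := g.ne_zero
  rw [sub_eq_iff_eq_add'.mp h3.symm] at h1 h2
  rw [sub_eq_iff_eq_add'.mp h4.symm] at h2
  linear_combination (norm := skip) (-1 : ℂ) • h1 - h2
  simp only [mul_add, add_mul, mul_sub, sub_mul, smul_mul_assoc,
    mul_smul_comm, mul_assoc, smul_add, smul_sub]
  match_scalars <;> field_simp <;> ring

lemma ad2_comm_f1 (u : A) : d.ad2 (u * d.f1 - d.f1 * u) = d.ad2 u * d.f1 - d.f1 * d.ad2 u := by
  simp only [ad2_sub, ad2_mul, d.ad2_f1 g]; noncomm_ring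

lemma f1_Xo (i : ℕ) : d.Xo i * d.f1 - d.f1 * d.Xo i
    = (1 + q⁻¹) • d.Xo (i + 1) + (q - q⁻¹) • (d.Xe i * d.L) := by
  induction i with
  | zero => exact d.f1_Xo_zero
  | succ i ih =>
    rw [d.Xo_shift i, ← d.ad2_comm_f1 g, ih, d.Xo_shift (i + 1), d.Xe_shift]
    simp only [ad2_add, ad2_smul, ad2_mul, ad2_L, Xo_shift]; simp

lemma f1_Xe (i : ℕ) : d.Xe i * d.f1 - d.f1 * d.Xe i
    = (q⁻¹ - 1) • d.Xe (i + 1) + (q - q⁻¹) • (d.Xo (i + 1) * d.L) := by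
  induction i with
  | zero => exact d.f1_Xe_zero g.p_ne
  | succ i ih =>
    rw [d.Xe_shift i, ← d.ad2_comm_f1 g, ih, d.Xo_shift (i + 1), d.Xe_shift (i + 1)]
    simp only [ad2_add, ad2_smul, ad2_mul, ad2_L]; simp

lemma f1_Yo (i : ℕ) : d.Yo i * d.f1 - d.f1 * d.Yo i
    = (1 - q) • d.Yo (i + 1) - (q - q⁻¹) • (d.Ye i * d.L) := by
  induction i with
  | zero => exact d.f1_Yo_zero
  | succ i ih =>
    have h : d.ad2 (d.Yo i) = - d.Yo (i + 1) := by rw [Yo_shift, neg_neg]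
    have h' := d.ad2_comm_f1 g (d.Yo i)
    rw [ih, h] at h'
    have h1 : d.ad2 (d.Yo (i + 1)) = - d.Yo (i + 2) := by rw [d.Yo_shift (i + 1), neg_neg]
    have h2 : d.ad2 (d.Ye i) = - d.Ye (i + 1) := by rw [d.Ye_shift, neg_neg]
    simp only [ad2_add, ad2_sub, ad2_smul, ad2_mul, ad2_L, h1, h2] at h'
    linear_combination (norm := skip) (1 : ℂ) • h'
    simp only [mul_zero, add_zero, neg_mul, mul_neg]
    module

lemma f1_Ye (i : ℕ) : d.Ye i * d.f1 - d.f1 * d.Ye i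
    = -(1 + q) • d.Ye (i + 1) + (q - q⁻¹) • (d.Yo (i + 1) * d.L) := by
  induction i with
  | zero => exact d.f1_Ye_zero g.m_ne
  | succ i ih =>
    have h : d.ad2 (d.Ye i) = - d.Ye (i + 1) := by rw [Ye_shift, neg_neg]
    have h' := d.ad2_comm_f1 g (d.Ye i)
    rw [ih, h] at h'
    have h1 : d.ad2 (d.Ye (i + 1)) = - d.Ye (i + 2) := by rw [d.Ye_shift (i + 1), neg_neg]
    have h2 : d.ad2 (d.Yo (i + 1)) = - d.Yo (i + 2) := by rw [d.Yo_shift (i + 1), neg_neg]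
    simp only [ad2_add, ad2_sub, ad2_smul, ad2_mul, ad2_L, h1, h2] at h'
    linear_combination (norm := skip) (1 : ℂ) • h'
    simp only [mul_zero, add_zero, neg_mul, mul_neg]
    module

/-- `[T, f₁]` for the four families. -/
lemma Too_f1 (i j : ℕ) : d.Too i j * d.f1 - d.f1 * d.Too i j
    = (1 + q⁻¹) • d.Too (i + 1) j + (1 - q) • d.Too i (j + 1)
      + (q - q⁻¹) • d.Tee i j - (q - q⁻¹) • ((d.Teo i j + d.Toe i j) * d.L) :=
  d.f1_Too (d.f1_Xo g i) (d.f1_Yo g j)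

lemma Toe_f1 (i j : ℕ) : d.Toe i j * d.f1 - d.f1 * d.Toe i j
    = (1 + q⁻¹) • d.Toe (i + 1) j - (1 + q) • d.Toe i (j + 1)
      + (q - q⁻¹) • d.Teo i (j + 1) + (q - q⁻¹) • ((d.Tee i j + d.Too i (j + 1)) * d.L) :=
  d.f1_Toe (d.f1_Xo g i) (d.f1_Ye g j)

lemma Teo_f1 (i j : ℕ) : d.Teo i j * d.f1 - d.f1 * d.Teo i j
    = (q⁻¹ - 1) • d.Teo (i + 1) j + (1 - q) • d.Teo i (j + 1)
      + (q - q⁻¹) • d.Toe (i + 1) j - (q - q⁻¹) • ((d.Too (i + 1) j + d.Tee i j) * d.L) :=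
  d.f1_Teo (d.f1_Xe g i) (d.f1_Yo g j)

lemma Tee_f1 (i j : ℕ) : d.Tee i j * d.f1 - d.f1 * d.Tee i j
    = (q⁻¹ - 1) • d.Tee (i + 1) j - (1 + q) • d.Tee i (j + 1)
      + (q - q⁻¹) • d.Too (i + 1) (j + 1)
      + (q - q⁻¹) • ((d.Toe (i + 1) j + d.Teo i (j + 1)) * d.L) :=
  d.f1_Tee (d.f1_Xe g i) (d.f1_Ye g j)

end AltData

namespace AltData

variable {A : Type*} [Ring A] [Algebra ℂ A] {q : ℂ} (d : AltData A q)

/-- The even imaginary root vectors `L̃_{2n}`, extended by zero to negative indices. -/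
def f : ℤ → A
  | 0 => (q - q⁻¹)⁻¹ • 1
  | (n + 1 : ℕ) => (2 : ℂ)⁻¹ • (d.Toe 0 n + d.Teo 0 n)
  | Int.negSucc _ => 0

lemma f_zero : d.f 0 = (q - q⁻¹)⁻¹ • 1 := rfl

lemma f_succ (n : ℕ) : d.f (n + 1) = (2 : ℂ)⁻¹ • (d.Toe 0 n + d.Teo 0 n) := rfl

lemma f_one : d.f 1 = d.f1 := rfl

lemma f_neg {n : ℤ} (h : n < 0) : d.f n = 0 := by
  obtain ⟨k, rfl⟩ := Int.eq_negSucc_of_lt_zero h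
  rfl

/-- `Lp k` is `L'_{2k+1}`. -/
def Lp : ℕ → A
  | 0 => d.L
  | k + 1 => d.Tee 0 k

lemma Too_eq {k : ℕ} (h : ∀ j < k, d.ad2 (d.Too 0 j) = 0) (i : ℕ) :
    ∀ j, i + j ≤ k → d.Too i j = d.Too 0 (i + j) := by
  induction i with
  | zero => intro j _; rw [zero_add]
  | succ i ih =>
    intro j hj
    have h1 := d.ad2_Too i j
    rw [ih j (by omega), h _ (by omega), eq_comm, sub_eq_zero, ih (j + 1) (by omega)] at h1
    rw [h1]; congr 1; ring

lemma Toe_eq {k : ℕ} (h : ∀ j < k, d.ad2 (d.Toe 0 j) = 0) (i : ℕ) :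
    ∀ j, i + j ≤ k → d.Toe i j = d.Toe 0 (i + j) := by
  induction i with
  | zero => intro j _; rw [zero_add]
  | succ i ih =>
    intro j hj
    have h1 := d.ad2_Toe i j
    rw [ih j (by omega), h _ (by omega), eq_comm, sub_eq_zero, ih (j + 1) (by omega)] at h1
    rw [h1]; congr 1; ring

lemma Teo_eq {k : ℕ} (h : ∀ j < k, d.ad2 (d.Teo 0 j) = 0) (i : ℕ) :
    ∀ j, i + j ≤ k → d.Teo i j = d.Teo 0 (i + j) := by
  induction i with
  | zero => intro j _; rw [zero_add]
  | succ i ih =>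
    intro j hj
    have h1 := d.ad2_Teo i j
    rw [ih j (by omega), h _ (by omega), eq_comm, sub_eq_zero, ih (j + 1) (by omega)] at h1
    rw [h1]; congr 1; ring

lemma Tee_eq {k : ℕ} (h : ∀ j < k, d.ad2 (d.Tee 0 j) = 0) (i : ℕ) :
    ∀ j, i + j ≤ k → d.Tee i j = d.Tee 0 (i + j) := by
  induction i with
  | zero => intro j _; rw [zero_add]
  | succ i ih =>
    intro j hj
    have h1 := d.ad2_Tee i j
    rw [ih j (by omega), h _ (by omega), eq_comm, sub_eq_zero, ih (j + 1) (by omega)] at h1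
    rw [h1]; congr 1; ring

/-- All imaginary root vectors of low degree commute with `L²`. -/
structure Stage (k : ℕ) : Prop where
  oo : ∀ j ≤ k, d.ad2 (d.Too 0 j) = 0
  oe : ∀ j < k, d.ad2 (d.Toe 0 j) = 0
  eo : ∀ j < k, d.ad2 (d.Teo 0 j) = 0
  ee : ∀ j < k, d.ad2 (d.Tee 0 j) = 0

lemma ad2_Toe_eq_ad2_Teo {k : ℕ} (h : d.ad2 (d.Too 0 k) = 0) :
    d.ad2 (d.Toe 0 k) = d.ad2 (d.Teo 0 k) := by
  rw [← sub_eq_zero, ← ad2_sub, ← d.Too_L, ad2_add, ad2_mul, ad2_mul, h, ad2_L]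
  simp

lemma ad2_f_succ {k : ℕ} (h : d.ad2 (d.Too 0 k) = 0) :
    d.ad2 (d.f (k + 1)) = d.ad2 (d.Toe 0 k) := by
  rw [f_succ, ad2_smul, ad2_add, ← d.ad2_Toe_eq_ad2_Teo h]
  module

lemma stage (g : Generic q) (k : ℕ) (h : ∀ j : ℤ, j ≤ k → d.ad2 (d.f j) = 0) : d.Stage k := by
  induction k with
  | zero =>
    refine ⟨fun j hj => ?_, by simp, by simp, by simp⟩
    obtain rfl : j = 0 := by omega
    rw [Too_zero, ad2_L]
  | succ k ih =>
    have S := ih fun j hj => h j (by push_cast; omega)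
    have h0 := S.oo k le_rfl
    have h1 : d.ad2 (d.Toe 0 k) = 0 := by rw [← d.ad2_f_succ h0]; exact h _ (by push_cast; rfl)
    have h2 : d.ad2 (d.Teo 0 k) = 0 := by rw [← d.ad2_Toe_eq_ad2_Teo h0, h1]
    have oe : ∀ j < k + 1, d.ad2 (d.Toe 0 j) = 0 := fun j hj => by
      rcases Nat.lt_succ_iff_lt_or_eq.mp hj with hj | rfl
      exacts [S.oe j hj, h1]
    have eo : ∀ j < k + 1, d.ad2 (d.Teo 0 j) = 0 := fun j hj => by
      rcases Nat.lt_succ_iff_lt_or_eq.mp hj with hj | rfl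
      exacts [S.eo j hj, h2]
    have h3 : d.ad2 (d.Tee 0 k) = d.ad2 (d.Too 0 (k + 1)) := by
      rw [← sub_eq_zero, ← ad2_sub, ← d.Toe_L, ad2_sub, ad2_mul, ad2_mul, h1, ad2_L]
      simp
    have e1 := d.ad2_Too 0 k
    have e2 := d.ad2_Toe 0 k
    have e3 := d.ad2_Teo 0 k
    have e4 := d.ad2_Too 0 (k + 1)
    have e5 := d.ad2_Too 1 k
    have e6 := d.ad2_Tee 0 k
    have e7 := d.Too_f1 g 0 (k + 1)
    have e8 := d.Too_f1 g 1 k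
    rw [h0, eq_comm, sub_eq_zero] at e1
    rw [h1, eq_comm, sub_eq_zero] at e2
    rw [h2, eq_comm, sub_eq_zero] at e3
    rw [h3] at e6
    simp only [zero_add] at e1 e2 e3 e4 e5 e6 e7 e8
    rw [e1] at e5
    rw [e1, e2, e3] at e8
    have h4 : d.ad2 (d.Too 0 (k + 1)) = 0 := by
      refine (smul_eq_zero.mp (?_ : (2 : ℂ) • (_ : A) = 0)).resolve_left two_ne_zero
      have hq := g.ne_zero
      linear_combination (norm := skip) e7 - e8 + (1 - q) • e4 + (1 + q⁻¹) • e5 + (q - q⁻¹) • e6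
      match_scalars <;> field_simp <;> ring
    refine ⟨fun j hj => ?_, oe, eo, fun j hj => ?_⟩
    · rcases Nat.le_succ_iff.mp hj with hj | rfl
      exacts [S.oo j hj, h4]
    · rcases Nat.lt_succ_iff_lt_or_eq.mp hj with hj | rfl
      exacts [S.ee j hj, h3.trans h4]

/-- The quadratic relation between two families of imaginary root vectors. -/
lemma quad_rel {X X' Y Y' P Q Q' R : A} (hq : q ≠ 0)
    (h1 : X * P - P * X = q • (X' * Q) - q⁻¹ • (Q * X'))
    (h2 : X * Q' - Q' * X = q • (X' * R) + q⁻¹ • (R * X'))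
    (h3 : P * Y + Y * P = q • (Q' * Y') - q⁻¹ • (Y' * Q'))
    (h4 : Q * Y - Y * Q = q • (R * Y') - q⁻¹ • (Y' * R)) :
    (X * Y - q⁻¹ • (Y * X)) * P + P * (X * Y - q⁻¹ • (Y * X))
      + q⁻¹ • ((X * Y' - q⁻¹ • (Y' * X)) * Q') - q • (Q' * (X * Y' - q⁻¹ • (Y' * X)))
      + q • ((X' * Y + q⁻¹ • (Y * X')) * Q) - q⁻¹ • (Q * (X' * Y + q⁻¹ • (Y * X')))
      - ((X' * Y' - q⁻¹ • (Y' * X')) * R + R * (X' * Y' - q⁻¹ • (Y' * X'))) = 0 := by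
  have a1 := congrArg (X * ·) h3
  have a2 := congrArg (· * Y) h1
  have a3 := congrArg (Y * ·) h1
  have a4 := congrArg (· * X) h3
  have a5 := congrArg (X' * ·) h4
  have a6 := congrArg (· * Y') h2
  have a7 := congrArg (· * X') h4
  have a8 := congrArg (Y' * ·) h2
  linear_combination (norm := skip) a1 - a2 - q⁻¹ • a3 - q⁻¹ • a4 - q • a5 + q • a6
    - (q⁻¹ * q⁻¹) • a7 - (q⁻¹ * q⁻¹) • a8
  simp only [mul_add, add_mul, mul_sub, sub_mul, smul_mul_assoc,
    mul_smul_comm, mul_assoc, smul_add, smul_sub]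
  match_scalars <;> field_simp <;> ring

end AltData

namespace AltData

variable {A : Type*} [Ring A] [Algebra ℂ A] {q : ℂ} (d : AltData A q)

/-- `y a = 2^{-a} (ad f₁)^a L`. -/
def y : ℕ → A
  | 0 => d.L
  | a + 1 => (2 : ℂ)⁻¹ • (d.f1 * y a - y a * d.f1)

lemma y_zero : d.y 0 = d.L := rfl

lemma y_succ (a : ℕ) : d.y (a + 1) = (2 : ℂ)⁻¹ • (d.f1 * d.y a - d.y a * d.f1) := rfl

lemma f_zero_mul (u : A) : d.f 0 * u = (q - q⁻¹)⁻¹ • u := by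
  rw [f_zero, smul_mul_assoc, one_mul]

lemma mul_f_zero (u : A) : u * d.f 0 = (q - q⁻¹)⁻¹ • u := by
  rw [f_zero, mul_smul_comm, mul_one]

lemma Lp_succ (n : ℕ) : d.Lp (n + 1) = d.Tee 0 n := rfl

variable (g : Generic q) {k : ℕ} (S : d.Stage k)

include g S in
lemma comm_f1_f {n : ℕ} (hn : n ≤ k) :
    d.f (n + 1) * d.f1 - d.f1 * d.f (n + 1) = ((q + q⁻¹) / 2) • d.ad2 (d.f (n + 1)) := by
  have e1 := d.ad2_Toe 0 n
  have e2 := d.ad2_Teo 0 n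
  have e3 := d.ad2_Toe_eq_ad2_Teo (S.oo n hn)
  have e4 := d.ad2_Too 0 n
  have h1 := d.Toe_f1 g 0 n
  have h2 := d.Teo_f1 g 0 n
  rw [d.ad2_f_succ (S.oo n hn)]
  rw [S.oo n hn, eq_comm, sub_eq_zero] at e4
  rw [← e3] at e2
  simp only [zero_add] at e1 e2 e4 h1 h2
  rw [e4] at h2
  rw [f_succ]
  have hq := g.ne_zero
  linear_combination (norm := skip) (2 : ℂ)⁻¹ • h1 + (2 : ℂ)⁻¹ • h2
    + (-(1 + q⁻¹ + (q - q⁻¹)) / 2) • e1 - ((q⁻¹ - 1) / 2) • e2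
  simp only [mul_add, add_mul, smul_mul_assoc, mul_smul_comm, smul_add, smul_sub]
  match_scalars <;> field_simp <;> ring

include S in
lemma KO_succ {n : ℕ} (hn : n ≤ k) :
    d.Too 0 (n + 1) - d.Tee 0 n = -(d.f (n + 1) * d.L - d.L * d.f (n + 1)) := by
  have e4 := d.ad2_Too 0 n
  have h1 := d.Toe_L 0 n
  have h2 := d.Teo_L 0 n
  rw [S.oo n hn, eq_comm, sub_eq_zero] at e4
  simp only [zero_add] at e4 h1 h2
  rw [e4] at h2
  rw [f_succ]
  linear_combination (norm := skip) (2 : ℂ)⁻¹ • h1 + (2 : ℂ)⁻¹ • h2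
  simp only [mul_add, add_mul, smul_mul_assoc, mul_smul_comm, smul_add, smul_sub]
  match_scalars <;> norm_num

/-- `Too 0 n - Lp n = -[f n, L]`. -/
lemma KO {n : ℕ} (S : d.Stage k) (hn : n ≤ k + 1) :
    d.Too 0 n - d.Lp n = -(d.f n * d.L - d.L * d.f n) := by
  cases n with
  | zero => simp [Lp, Too_zero, f_zero_mul, mul_f_zero]
  | succ n => rw [Lp]; exact_mod_cast d.KO_succ S (by omega)

include g S in
lemma Too_f1' {n : ℕ} (hn : n ≤ k) : d.Too 0 n * d.f1 - d.f1 * d.Too 0 n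
    = (2 - (q - q⁻¹)) • d.Too 0 (n + 1) + (q - q⁻¹) • d.Tee 0 n
      - (2 * (q - q⁻¹)) • (d.f (n + 1) * d.L) := by
  have e4 := d.ad2_Too 0 n
  have h1 := d.Too_f1 g 0 n
  rw [S.oo n hn, eq_comm, sub_eq_zero] at e4
  simp only [zero_add] at e4 h1
  rw [e4] at h1
  rw [h1, f_succ, smul_mul_assoc]
  simp only [add_mul]
  have hq := g.ne_zero
  match_scalars <;> field_simp <;> ring

include g S in
lemma Lp_f1 {n : ℕ} (hn : n ≤ k) : d.Lp n * d.f1 - d.f1 * d.Lp n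
    = (q - q⁻¹) • d.Too 0 (n + 1) - (2 + (q - q⁻¹)) • d.Tee 0 n
      + (2 * (q - q⁻¹)) • (d.f (n + 1) * d.L) := by
  have hq := g.ne_zero
  cases n with
  | zero =>
    have h := d.KO_succ S hn
    simp only [CharP.cast_eq_zero, zero_add, Lp, f_one] at h ⊢
    rw [sub_eq_iff_eq_add.mp h, Tee_zero]
    simp only [smul_add, smul_sub]
    match_scalars <;> field_simp <;> ring
  | succ n =>
    have e1 := d.ad2_Tee 0 n
    have e2 := d.ad2_Toe 0 n
    have e3 := d.ad2_Too 0 (n + 1)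
    have h1 := d.Tee_f1 g 0 n
    rw [S.ee n (by omega), eq_comm, sub_eq_zero] at e1
    rw [S.oe n (by omega), eq_comm, sub_eq_zero] at e2
    rw [S.oo (n + 1) (by omega), eq_comm, sub_eq_zero] at e3
    simp only [zero_add] at e1 e2 e3 h1
    rw [e1, e2, e3] at h1
    rw [Lp, h1, f_succ, smul_mul_assoc]
    simp only [add_mul]
    match_scalars <;> field_simp <;> ring

/-- The average of `L_{2n+1}` and `L'_{2n+1}`. -/
def ell (n : ℕ) : A := (2 : ℂ)⁻¹ • (d.Too 0 n + d.Lp n)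

lemma Too_eq_ell (S : d.Stage k) {n : ℕ} (hn : n ≤ k + 1) :
    d.Too 0 n = d.ell n - (2 : ℂ)⁻¹ • (d.f n * d.L - d.L * d.f n) := by
  have h := d.KO S hn
  rw [ell]
  linear_combination (norm := module) (2 : ℂ)⁻¹ • h

lemma Lp_eq_ell (S : d.Stage k) {n : ℕ} (hn : n ≤ k + 1) :
    d.Lp n = d.ell n + (2 : ℂ)⁻¹ • (d.f n * d.L - d.L * d.f n) := by
  have h := d.KO S hn
  rw [ell]
  linear_combination (norm := module) (-2 : ℂ)⁻¹ • h

include g S in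
lemma ell_f1 {n : ℕ} (hn : n ≤ k) :
    d.ell n * d.f1 - d.f1 * d.ell n = -(d.f (n + 1) * d.L - d.L * d.f (n + 1)) := by
  have h1 := d.Too_f1' g S hn
  have h2 := d.Lp_f1 g S hn
  have h3 := d.KO_succ S hn
  have hq := g.ne_zero
  rw [ell]
  linear_combination (norm := skip) (2 : ℂ)⁻¹ • h1 + (2 : ℂ)⁻¹ • h2 + h3
  simp only [smul_add, smul_sub, smul_mul_assoc, mul_smul_comm, add_mul, mul_add]
  match_scalars <;> field_simp <;> ring

/-- The hypothesis under which the induction step is performed: the `f j`, `j ≤ k`, commute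
with `L²`. -/
structure Comm (k : ℕ) : Prop where
  comm : ∀ j : ℤ, j ≤ k → d.ad2 (d.f j) = 0

variable {d} in
lemma Comm.comm_f1 (g : Generic q) (h : d.Comm k) {j : ℤ} (hj : j ≤ k) :
    d.f j * d.f1 = d.f1 * d.f j := by
  rcases lt_trichotomy j 0 with h0 | rfl | h0
  · rw [d.f_neg h0]; simp
  · rw [f_zero_mul, mul_f_zero]
  · obtain ⟨n, rfl⟩ : ∃ n : ℕ, j = n + 1 := ⟨(j - 1).toNat, by omega⟩
    rw [← sub_eq_zero, d.comm_f1_f g (d.stage g k h.comm) (by omega), h.comm _ hj, smul_zero]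

include g in
lemma ell_eq (h : d.Comm k) {n : ℕ} (hn : n ≤ k + 1) :
    d.ell n = ((q - q⁻¹) / 2) • (d.f n * d.L + d.L * d.f n)
      + (2 : ℂ)⁻¹ • (d.f (n - 1) * d.y 1 - d.y 1 * d.f (n - 1)) := by
  have S := d.stage g k h.comm
  have hq := g.ne_zero
  have ht := g.theta_ne
  cases n with
  | zero =>
    simp only [ell, Lp, Too_zero, CharP.cast_eq_zero, zero_sub, f_zero_mul, mul_f_zero,
      d.f_neg (show (-1 : ℤ) < 0 by norm_num)]
    simp only [zero_mul, mul_zero, sub_zero, smul_zero, add_zero]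
    match_scalars
    generalize q - q⁻¹ = t at ht ⊢
    field_simp
  | succ n =>
    have hn : n ≤ k := by omega
    have h1 := d.Too_f1' g S hn
    have h2 := d.Lp_f1 g S hn
    have h3 := d.KO_succ S hn
    have h4 := d.KO S (show n ≤ k + 1 by omega)
    have h5 := h.comm_f1 g (show (n : ℤ) ≤ k by omega)
    have h6 := congrArg (· * d.f1) h4
    have h7 := congrArg (d.f1 * ·) h4
    have h8 := congrArg (d.L * ·) h5
    have h9 := congrArg (· * d.L) h5
    push_cast
    simp only [add_sub_cancel_right, ell, y_succ, y_zero, Lp_succ] at h6 h7 h8 h9 ⊢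
    linear_combination (norm := skip) (-4 : ℂ)⁻¹ • h1 + (4 : ℂ)⁻¹ • h2
      + (-(2 : ℂ)⁻¹ * (q - q⁻¹)) • (-h3) + (4 : ℂ)⁻¹ • (h6 - h7)
      + (4 : ℂ)⁻¹ • h8 - (4 : ℂ)⁻¹ • h9
    simp only [smul_add, smul_sub, smul_mul_assoc, mul_smul_comm, add_mul, mul_add, mul_sub, sub_mul,
      mul_assoc, neg_mul, mul_neg]
    match_scalars <;> field_simp <;> ring

end AltData

namespace AltData

variable {A : Type*} [Ring A] [Algebra ℂ A] {q : ℂ} (d : AltData A q)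

/-- The exchange relation between `f j` and `y a`. -/
def Rel (j : ℤ) (a : ℕ) : Prop :=
  d.f j * d.y a - d.y a * d.f j
    = (q - q⁻¹) • (d.f (j - 1) * d.y (a + 1) + d.y (a + 1) * d.f (j - 1))
      + (d.f (j - 2) * d.y (a + 2) - d.y (a + 2) * d.f (j - 2))

variable {d}

lemma rel_zero (g : Generic q) {k : ℕ} (h : d.Comm k) {j : ℤ} (hj : j ≤ k + 1) : d.Rel j 0 := by
  rw [Rel]
  by_cases h0 : j ≤ 0
  · rw [d.f_neg (show j - 1 < 0 by omega), d.f_neg (show j - 2 < 0 by omega)]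
    rcases h0.lt_or_eq with h0 | rfl
    · rw [d.f_neg h0]; simp
    · rw [f_zero_mul, mul_f_zero]; simp
  · obtain ⟨n, rfl⟩ : ∃ n : ℕ, j = n + 1 := ⟨(j - 1).toNat, by omega⟩
    have hn : n ≤ k := by omega
    have h1 := d.ell_f1 g (d.stage g k h.comm) hn
    rw [d.ell_eq g h (by omega)] at h1
    have h5 := h.comm_f1 g (show (n : ℤ) ≤ k by omega)
    have h6 := h.comm_f1 g (show (n - 1 : ℤ) ≤ k by omega)
    have h5' := fun z => congrArg (· * z) h5
    have h6' := fun z => congrArg (· * z) h6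
    rw [show (n : ℤ) + 1 - 2 = n - 1 by ring, add_sub_cancel_right, y_zero]
    simp only [mul_assoc] at h5' h6'
    linear_combination (norm := skip) h1
    simp only [smul_add, smul_sub, smul_mul_assoc, mul_smul_comm, add_mul, mul_add, mul_sub,
      sub_mul, mul_assoc, neg_mul, mul_neg, y_succ, y_zero, h5, h6, h5', h6']
    match_scalars <;> ring

lemma Rel.succ {j : ℤ} {a : ℕ} (h : d.Rel j a) (h0 : d.f j * d.f1 = d.f1 * d.f j)
    (h1 : d.f (j - 1) * d.f1 = d.f1 * d.f (j - 1)) (h2 : d.f (j - 2) * d.f1 = d.f1 * d.f (j - 2)) :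
    d.Rel j (a + 1) := by
  rw [Rel] at h ⊢
  have h0' := fun z => congrArg (· * z) h0
  have h1' := fun z => congrArg (· * z) h1
  have h2' := fun z => congrArg (· * z) h2
  have e1 := congrArg (· * d.f1) h
  have e2 := congrArg (d.f1 * ·) h
  rw [y_succ _ a, y_succ _ (a + 1), y_succ _ (a + 2)]
  simp only [mul_assoc] at h0' h1' h2'
  linear_combination (norm := skip) (2 : ℂ)⁻¹ • e2 - (2 : ℂ)⁻¹ • e1
  simp only [smul_add, smul_sub, smul_mul_assoc, mul_smul_comm, add_mul, mul_add, mul_sub,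
      sub_mul, mul_assoc, neg_mul, mul_neg, h0, h1, h2, h0', h1', h2']
  match_scalars <;> ring

lemma rel_of_le (g : Generic q) {k : ℕ} (h : d.Comm k) {j : ℤ} (hj : j ≤ k) (a : ℕ) :
    d.Rel j a := by
  induction a with
  | zero => exact rel_zero g h (by omega)
  | succ a ih =>
    exact ih.succ (h.comm_f1 g hj) (h.comm_f1 g (by omega)) (h.comm_f1 g (by omega))

lemma rel_weight (g : Generic q) {k : ℕ} (h : d.Comm k) {j : ℤ} {a : ℕ}
    (hj : j + 2 * a ≤ k + 1) : d.Rel j a := by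
  cases a with
  | zero => exact rel_zero g h (by omega)
  | succ a => exact rel_of_le g h (by push_cast at hj; omega) _

variable (d) in
/-- `D j a = [f j, y_a²]`. -/
def D (j : ℤ) (a : ℕ) : A := d.f j * (d.y a * d.y a) - d.y a * d.y a * d.f j

lemma anti_y {a : ℕ} (h : d.D 1 a = 0) : d.y (a + 1) * d.y a = -(d.y a * d.y (a + 1)) := by
  rw [D, f_one] at h
  rw [y_succ]
  linear_combination (norm := skip) (2 : ℂ)⁻¹ • h
  simp only [smul_add, smul_sub, smul_mul_assoc, mul_smul_comm, add_mul, mul_add, mul_sub,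
      sub_mul, mul_assoc, neg_mul, mul_neg]
  module

lemma anti_y_two {a : ℕ} (h : d.D 1 a = 0) :
    d.y (a + 2) * d.y a + d.y a * d.y (a + 2) = (-2 : ℂ) • (d.y (a + 1) * d.y (a + 1)) := by
  have h := anti_y h
  have h1 := congrArg (d.f1 * ·) h
  have h2 := congrArg (· * d.f1) h
  rw [y_succ _ (a + 1)]
  have h3 : d.f1 * d.y a = (2 : ℂ) • d.y (a + 1) + d.y a * d.f1 := by rw [y_succ]; module
  have h3' : ∀ z, d.f1 * (d.y a * z) = (2 : ℂ) • (d.y (a + 1) * z) + d.y a * (d.f1 * z) := fun z => by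
    rw [← mul_assoc, h3]; simp only [add_mul, smul_mul_assoc, mul_assoc]
  linear_combination (norm := skip) (2 : ℂ)⁻¹ • h1 - (2 : ℂ)⁻¹ • h2
  simp only [smul_add, smul_sub, smul_mul_assoc, mul_smul_comm, add_mul, mul_add, mul_sub,
      sub_mul, mul_assoc, neg_mul, mul_neg, h3, h3']
  match_scalars <;> norm_num

lemma D_rec {j : ℤ} {a : ℕ} (h : d.D 1 a = 0) (h0 : d.Rel j a) (h1 : d.Rel (j - 1) a)
    (h2 : d.Rel (j - 2) a) : d.D j a
      = -((q - q⁻¹) ^ 2 + 2) • d.D (j - 2) (a + 1)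
        - (q - q⁻¹) • (d.f (j - 3) * (d.y (a + 1) * d.y (a + 2) + d.y (a + 2) * d.y (a + 1))
          + (d.y (a + 1) * d.y (a + 2) + d.y (a + 2) * d.y (a + 1)) * d.f (j - 3))
        - d.D (j - 4) (a + 2) := by
  have k1 := anti_y h
  have k2 := anti_y_two h
  rw [Rel] at h0 h1 h2
  rw [show j - 1 - 1 = j - 2 by ring, show j - 1 - 2 = j - 3 by ring] at h1
  rw [show j - 2 - 1 = j - 3 by ring, show j - 2 - 2 = j - 4 by ring] at h2
  rw [D, D, D]
  generalize d.f j = F0 at *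
  generalize d.f (j - 1) = F1 at *
  generalize d.f (j - 2) = F2 at *
  generalize d.f (j - 3) = F3 at *
  generalize d.f (j - 4) = F4 at *
  generalize d.y a = y0 at *
  generalize d.y (a + 1) = y1 at *
  generalize d.y (a + 2) = y2 at *
  generalize q - q⁻¹ = t at *
  have a1 := congrArg (· * y0) h0
  have a2 := congrArg (y0 * ·) h0
  have a3 := congrArg (· * y1) h1
  have a4 := congrArg (y1 * ·) h1
  have a5 := congrArg (· * y2) h2
  have a6 := congrArg (y2 * ·) h2
  have a7 := congrArg (F1 * ·) k1
  have a8 := congrArg (· * F1) k1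
  have a9 := congrArg (F2 * ·) k2
  have b1 := congrArg (· * F2) k2
  linear_combination (norm := skip) a1 + a2 + t • a4 - t • a3 - a5 - a6 + t • a7 + t • a8
    + a9 - b1
  simp only [smul_add, smul_sub, smul_mul_assoc, mul_smul_comm, add_mul, mul_add, mul_sub,
      sub_mul, mul_assoc, neg_mul, mul_neg]
  match_scalars <;> ring

end AltData

namespace AltData

variable {A : Type*} [Ring A] [Algebra ℂ A] {q : ℂ} {d : AltData A q}

lemma D_zero_right (j : ℤ) : d.D j 0 = d.ad2 (d.f j) := rfl

lemma D_neg {j : ℤ} (a : ℕ) (h : j < 0) : d.D j a = 0 := by simp [D, d.f_neg h]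

lemma D_zero (a : ℕ) : d.D 0 a = 0 := by rw [D, f_zero_mul, mul_f_zero, sub_self]

lemma key_identity {F f L fk fk' y1 y2 P Q Q' R T11 T12 T21 T22 : A} (hq : q ≠ 0)
    (hF : F * L - L * F = (q - q⁻¹) • (fk * y1 + y1 * fk) + (fk' * y2 - y2 * fk'))
    (hFf : F * f - f * F = ((q + q⁻¹) / 2) • (F * (L * L) - L * L * F))
    (hfk : f * fk = fk * f) (hfk' : f * fk' = fk' * f) (h1 : f * L = L * f + (2 : ℂ) • y1)
    (h2 : f * y1 = y1 * f + (2 : ℂ) • y2) (hy : L * y1 + y1 * L = 0)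
    (hR : R * (L * L) - L * L * R = 0)
    (hRe : R = ((q - q⁻¹) / 2) • (fk * L + L * fk) + (2 : ℂ)⁻¹ • (fk' * y1 - y1 * fk')
      - (2 : ℂ)⁻¹ • (fk * L - L * fk))
    (hP : P = ((q - q⁻¹) / 2) • (F * L + L * F) + (2 : ℂ)⁻¹ • (fk * y1 - y1 * fk)
      + (2 : ℂ)⁻¹ • (F * L - L * F))
    (hQ : Q = F + (2 : ℂ)⁻¹ • (R * L + L * R)) (hQ' : Q' = F - (2 : ℂ)⁻¹ • (R * L + L * R))
    (h11 : T11 = L) (h12 : T12 = f + L * L) (h21 : T21 = f - L * L)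
    (h22 : T22 = ((1 + (q - q⁻¹)) / 2) • (f * L) - ((1 - (q - q⁻¹)) / 2) • (L * f))
    (h : T11 * P + P * T11 + q⁻¹ • (T12 * Q') - q • (Q' * T12) + q • (T21 * Q)
      - q⁻¹ • (Q * T21) - (T22 * R + R * T22) = 0) :
    (1 - (q + q⁻¹) ^ 2) • (F * (L * L) - L * L * F)
      = fk' * (y1 * y1) - y1 * y1 * fk' := by
  subst h11 h12 h21 h22 hQ hQ' hP
  have a1 := congrArg (· * T11) hF
  have a2 := congrArg (T11 * ·) hF
  have a3 := congrArg (· * T11) hR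
  have a4 := congrArg (T11 * ·) hR
  have a5 := congrArg (· * fk) hy
  have a6 := congrArg (fk * ·) hy
  rw [hRe] at a3 a4 h
  have h0 : f * F = F * f - ((q + q⁻¹) / 2) • (F * (T11 * T11) - T11 * T11 * F) := by
    rw [← hFf]; abel
  have h0' := fun z => congrArg (· * z) h0
  have h1' := fun z => congrArg (· * z) h1
  have h2' := fun z => congrArg (· * z) h2
  have h3' := fun z => congrArg (· * z) hfk
  have h4' := fun z => congrArg (· * z) hfk'
  simp only [mul_assoc] at h0' h1' h2' h3' h4'
  linear_combination (norm := skip) (2 : ℂ) • h - (q - q⁻¹) • a2 + (q - q⁻¹) • a1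
    - (q + q⁻¹) • (a3 + a4) - a6 + a5 + (q - q⁻¹) • (a5 + a6)
  simp only [smul_add, smul_sub, smul_mul_assoc, mul_smul_comm, add_mul, mul_add, mul_sub,
      sub_mul, mul_assoc, neg_mul, mul_neg, zero_mul, mul_zero, h0, h1, h2, hfk, hfk', h0', h1', h2', h3', h4']
  match_scalars <;> field_simp <;> ring

lemma D_top (g : Generic q) {k : ℕ} (hk : 1 ≤ k) (h : d.Comm k) :
    (1 - (q + q⁻¹) ^ 2) • d.D (k + 1) 0 = d.D (k - 1) 1 := by
  have S := d.stage g k h.comm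
  have hr := rel_zero g h (j := k + 1) le_rfl
  rw [Rel] at hr
  have e1 : ((k : ℤ) + 1 - 1) = k := by ring
  have e2 : ((k : ℤ) + 1 - 2) = k - 1 := by ring
  rw [e1, e2, y_zero] at hr
  have hf := d.comm_f1_f g S (le_refl k)
  have hc1 := h.comm_f1 g (j := k) le_rfl
  have hc2 := h.comm_f1 g (j := (k : ℤ) - 1) (by omega)
  have y1 := d.y_succ 0
  have y2 := d.y_succ 1
  rw [d.y_zero] at y1
  have hy : d.L * d.y 1 + d.y 1 * d.L = 0 := by
    have h1 := anti_y (d := d) (a := 0) (by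
      have := d.ad2_f1 g
      simpa [D, ad2, f_one, y_zero] using this)
    rw [y_zero] at h1
    rw [h1]; abel
  have ro := d.Too_eq_ell S (n := k) (by omega)
  have eo := d.Lp_eq_ell S (n := k + 1) (by omega)
  have l1 := d.ell_eq g h (n := k) (by omega)
  have l2 := d.ell_eq g h (n := k + 1) (by omega)
  have q3 := d.exch_Tee_Y k
  have q4 := d.exch_Toe_Y k
  rw [d.Tee_eq S.ee k 0 le_rfl, d.Teo_eq S.eo k 0 le_rfl] at q3
  rw [d.Toe_eq S.oe k 0 le_rfl, d.Too_eq (fun j hj => S.oo j hj.le) k 0 le_rfl] at q4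
  have hq := quad_rel g.ne_zero (d.exch_X_Tee k) (d.exch_X_Teo k) q3 q4
  have hs := d.Too_L 0 k
  have hF : d.f (k + 1) = (2 : ℂ)⁻¹ • (d.Toe 0 k + d.Teo 0 k) := d.f_succ k
  have := key_identity (L := d.L) g.ne_zero hr hf (hc1.symm) hc2.symm
    (f := d.f1) (y1 := d.y 1) (y2 := d.y 2)
    (by rw [y1]; module) (by rw [y2]; module) hy (S.oo k le_rfl) (ro.trans (by rw [l1]))
    (P := d.Tee 0 k) (eo.trans (by rw [l2, Nat.cast_succ, e1])) (Q := d.Toe 0 k) (Q' := d.Teo 0 k)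
    (by rw [hs, hF]; module) (by rw [hs, hF]; module) d.Too_zero d.Toe_zero d.Teo_zero d.Tee_zero hq
  exact this

end AltData

namespace AltData

variable {A : Type*} [Ring A] [Algebra ℂ A] {q : ℂ} {d : AltData A q}

variable (d) in
/-- `f j` commutes with `(y a)²` for all `j + 2 a ≤ k`. -/
def Good (k : ℕ) : Prop := ∀ (j : ℤ) (a : ℕ), j + 2 * a ≤ k → d.D j a = 0

lemma D_nonpos {j : ℤ} (a : ℕ) (h : j ≤ 0) : d.D j a = 0 := by
  rcases h.lt_or_eq with h | rfl
  · exact D_neg a h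
  · exact D_zero a

lemma good_zero : d.Good 0 := fun j a h => D_nonpos a (by push_cast at h; omega)

lemma Good.comm {k : ℕ} (h : d.Good k) : d.Comm k :=
  ⟨fun j hj => by rw [← D_zero_right]; exact h j 0 (by simpa using hj)⟩

lemma Good.D_rec (g : Generic q) {k : ℕ} (h : d.Good k) {j : ℤ} {a : ℕ} (hj : j + 2 * a = k + 1)
    (h2 : 2 ≤ j) : d.D j a
      = -((q - q⁻¹) ^ 2 + 2) • d.D (j - 2) (a + 1)
        - (q - q⁻¹) • (d.f (j - 3) * (d.y (a + 1) * d.y (a + 2) + d.y (a + 2) * d.y (a + 1))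
          + (d.y (a + 1) * d.y (a + 2) + d.y (a + 2) * d.y (a + 1)) * d.f (j - 3))
        - d.D (j - 4) (a + 2) :=
  AltData.D_rec (h 1 a (by omega)) (rel_weight g h.comm (by omega)) (rel_weight g h.comm (by omega))
    (rel_weight g h.comm (by omega))

lemma Good.D_rec' (g : Generic q) {k : ℕ} (h : d.Good k) {j : ℤ} {a : ℕ} (hj : j + 2 * a = k + 1)
    (h2 : 4 ≤ j) : d.D j a
      = -((q - q⁻¹) ^ 2 + 2) • d.D (j - 2) (a + 1) - d.D (j - 4) (a + 2) := by
  have h3 := anti_y (h 1 (a + 1) (by push_cast; omega))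
  rw [h.D_rec g hj (by omega), h3]
  simp

lemma Good.D_two (g : Generic q) {k : ℕ} (h : d.Good k) {a : ℕ} (hj : 2 + 2 * a = k + 1) :
    d.D 2 a = 0 := by
  rw [h.D_rec g (by omega) le_rfl, d.f_neg (by norm_num), D_nonpos _ (by norm_num),
    D_nonpos _ (by norm_num)]
  simp

lemma D_one (a : ℕ) : d.D 1 a = (2 : ℂ) • (d.y a * d.y (a + 1) + d.y (a + 1) * d.y a) := by
  rw [D, f_one, y_succ]
  simp only [smul_mul_assoc, mul_smul_comm, mul_sub, sub_mul, mul_assoc]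
  module

lemma Good.D_three (g : Generic q) {k : ℕ} (h : d.Good k) {a : ℕ} (hj : 3 + 2 * a = k + 1) :
    d.D 3 a = -((q - q⁻¹) ^ 2 + 3) • d.D 1 (a + 1) := by
  have ht := g.theta_ne
  rw [h.D_rec g (by omega) (by norm_num), D_nonpos (j := 3 - 4) _ (by norm_num),
    show (3 : ℤ) - 3 = 0 by norm_num, show (3 : ℤ) - 2 = 1 by norm_num, f_zero_mul, mul_f_zero,
    D_one]
  generalize q - q⁻¹ = t at ht ⊢
  match_scalars <;> field_simp <;> ring

lemma Good.D_even (g : Generic q) {k : ℕ} (h : d.Good k) (i : ℕ) :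
    ∀ a : ℕ, 2 * i + 2 * a = k + 1 → d.D (2 * i) a = 0 := by
  induction i using Nat.strong_induction_on with
  | _ i ih =>
    intro a ha
    match i, ih with
    | 0, _ => exact D_nonpos _ (by simp)
    | 1, _ => exact h.D_two g (by omega)
    | i + 2, ih =>
      rw [h.D_rec' g (by push_cast; omega) (by push_cast; omega)]
      have h1 := ih (i + 1) (by omega) (a + 1) (by omega)
      have h2 := ih i (by omega) (a + 2) (by omega)
      rw [show (2 * ((i + 2 : ℕ) : ℤ) - 2) = 2 * ((i + 1 : ℕ) : ℤ) by push_cast; ring,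
        show (2 * ((i + 2 : ℕ) : ℤ) - 4) = 2 * (i : ℤ) by push_cast; ring, h1, h2]
      simp

lemma Good.D_odd (g : Generic q) {k : ℕ} (h : d.Good k) (i : ℕ) :
    ∀ a : ℕ, 2 * i + 1 + 2 * a = k + 1 → (q - q⁻¹) • d.D (2 * i + 1) a
      = ((-1) ^ i * (q ^ (2 * i + 1) - q⁻¹ ^ (2 * i + 1))) • d.D 1 (a + i) := by
  have hq := g.ne_zero
  induction i using Nat.strong_induction_on with
  | _ i ih =>
    intro a ha
    match i, ih with
    | 0, _ => simp
    | 1, _ =>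
      have := h.D_three g (a := a) (by omega)
      rw [show (2 * ((1 : ℕ) : ℤ) + 1) = 3 by norm_num, this, smul_smul]
      congr 1
      simp only [inv_pow]
      field_simp
      ring
    | i + 2, ih =>
      rw [h.D_rec' g (by push_cast; omega) (by push_cast; omega)]
      have h1 := ih (i + 1) (by omega) (a + 1) (by omega)
      have h2 := ih i (by omega) (a + 2) (by omega)
      rw [show (2 * ((i + 2 : ℕ) : ℤ) + 1 - 2) = 2 * ((i + 1 : ℕ) : ℤ) + 1 by push_cast; ring,
        show (2 * ((i + 2 : ℕ) : ℤ) + 1 - 4) = 2 * (i : ℤ) + 1 by push_cast; ring,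
        smul_sub, smul_comm, h1, h2, show a + 1 + (i + 1) = a + (i + 2) by ring,
        show a + 2 + i = a + (i + 2) by ring, smul_smul, ← sub_smul]
      congr 1
      simp only [inv_pow]
      field_simp
      ring

lemma Good.D_one_eq_zero (g : Generic q) {k p : ℕ} (h : d.Good k) (hp : k = 2 * p) (hp1 : 1 ≤ p) :
    d.D 1 p = 0 := by
  have hq := g.ne_zero
  obtain ⟨r, rfl⟩ : ∃ r, p = r + 1 := ⟨p - 1, by omega⟩
  have h1 := h.D_odd g (r + 1) 0 (by omega)
  have h2 := h.D_odd g r 1 (by omega)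
  have h3 := D_top g (by omega) h.comm
  rw [show (k : ℤ) + 1 = 2 * ((r + 1 : ℕ) : ℤ) + 1 by rw [hp]; push_cast; ring,
    show (k : ℤ) - 1 = 2 * (r : ℤ) + 1 by rw [hp]; push_cast; ring] at h3
  rw [zero_add] at h1
  rw [add_comm 1 r] at h2
  have h4 : ((q + q⁻¹) * (q ^ (2 * r + 4) - q⁻¹ ^ (2 * r + 4))) • d.D 1 (r + 1) = 0 := by
    have h5 : (1 - (q + q⁻¹) ^ 2) • ((q - q⁻¹) • d.D (2 * ((r + 1 : ℕ) : ℤ) + 1) 0)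
        = (q - q⁻¹) • d.D (2 * (r : ℤ) + 1) 1 := by rw [smul_comm, h3]
    rw [h1, h2, smul_smul, ← sub_eq_zero, ← sub_smul] at h5
    rcases neg_one_pow_eq_or ℂ r with e | e <;>
    · rw [pow_succ _ r, e] at h5
      first
      | (convert h5 using 2; simp only [inv_pow]; field_simp; ring1)
      | (rw [← neg_eq_zero, ← neg_smul]; convert h5 using 2; simp only [inv_pow]; field_simp; ring1)
  refine (smul_eq_zero.mp h4).resolve_left (mul_ne_zero g.two_ne fun h => ?_)
  rw [inv_pow, sub_eq_zero] at h
  refine g.pow_ne (2 * (2 * r + 4)) (by omega) ?_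
  rw [two_mul, pow_add]
  nth_rewrite 1 [h]
  exact inv_mul_cancel₀ (pow_ne_zero _ hq)

lemma Good.succ (g : Generic q) {k : ℕ} (h : d.Good k) : d.Good (k + 1) := by
  intro j a hja
  rcases hja.lt_or_eq with h1 | h1
  · exact h j a (by push_cast at h1; omega)
  push_cast at h1
  rcases le_or_gt j 0 with h0 | h0
  · exact D_nonpos a h0
  lift j to ℕ using h0.le
  obtain ⟨i, rfl | rfl⟩ := Nat.even_or_odd' j
  · simpa using h.D_even g i a (by omega)
  · have h2 : d.D 1 (a + i) = 0 := by
      rcases Nat.eq_zero_or_pos (a + i) with h3 | h3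
      · rw [h3, D_zero_right, f_one]; exact d.ad2_f1 g
      · exact h.D_one_eq_zero g (by omega) h3
    have h3 := h.D_odd g i a (by omega)
    rw [h2, smul_zero] at h3
    exact_mod_cast (smul_eq_zero.mp h3).resolve_left g.theta_ne

lemma D_eq_zero (g : Generic q) (j : ℤ) (a : ℕ) : d.D j a = 0 := by
  have : ∀ k, d.Good k := fun k => by
    induction k with
    | zero => exact good_zero
    | succ k ih => exact ih.succ g
  exact this (j + 2 * a).toNat j a (by omega)

lemma ad2_f (g : Generic q) (j : ℤ) : d.ad2 (d.f j) = 0 := D_eq_zero g j 0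

lemma comm (g : Generic q) (k : ℕ) : d.Comm k := ⟨fun j _ => ad2_f g j⟩

lemma stage' (g : Generic q) (k : ℕ) : d.Stage k := d.stage g k fun j _ => ad2_f g j

lemma rel (g : Generic q) (j : ℤ) (a : ℕ) : d.Rel j a :=
  rel_of_le g (comm g j.toNat) (by omega) a

end AltData

namespace AltData

section Clifford

variable {K B : Type*} [CommRing K] [Ring B] [Algebra K B] [Algebra ℂ B]

/-- The polarised anticommutation relations. -/
def Pol (c : ℕ → B) : Prop := ∀ i j,
  c (i + 1) * c j + c j * c (i + 1) + (c i * c (j + 1) + c (j + 1) * c i) = 0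

/-- The finite difference operator with symbol `1 - θ x z - x² z²`. -/
def dd (θ x : K) (c : ℕ → B) (j : ℕ) : B := c j - (θ * x) • c (j + 1) - (x * x) • c (j + 2)

def quadForm (θ x : K) (a : ℕ → B) : B :=
  a 0 * a 0 + (x * θ) • (a 0 * a 1) + (x * x) • (a 1 * a 1)

lemma eq_zero_of_add_self {x : B} (h : x + x = 0) : x = 0 := by
  have : (2 : ℂ) • x = 0 := by rw [two_smul, h]
  exact (smul_eq_zero.mp this).resolve_left two_ne_zero

lemma Pol.one {c : ℕ → B} (h : Pol c) (i : ℕ) : c (i + 1) * c i = -(c i * c (i + 1)) := by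
  have := eq_zero_of_add_self (x := c (i + 1) * c i + c i * c (i + 1))
    (by linear_combination (norm := abel) h i i)
  exact eq_neg_of_add_eq_zero_left this

lemma Pol.two {c : ℕ → B} (h : Pol c) (i : ℕ) :
    c (i + 2) * c i = -(c i * c (i + 2)) - (c (i + 1) * c (i + 1) + c (i + 1) * c (i + 1)) := by
  linear_combination (norm := abel) h (i + 1) i

lemma Pol.three {c : ℕ → B} (h : Pol c) (i : ℕ) :
    c (i + 3) * c i = -(c i * c (i + 3)) := by
  linear_combination (norm := abel) h (i + 2) i - h.one (i + 1)

lemma Pol.quad {a : ℕ → B} (h : Pol a) (θ s : K) :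
    (a 0 - s • a 1) * dd θ (-s) a 0 + dd θ s a 0 * (a 0 - s • a 1) = (2 : K) • quadForm θ s a := by
  simp only [dd, quadForm]
  have h1 := h.one 0
  have h2 := h.two 0
  have h3 := h.one 1
  simp only [zero_add, Nat.reduceAdd] at h1 h2 h3
  simp only [smul_add, smul_sub, smul_neg, smul_mul_assoc, mul_smul_comm, add_mul, mul_add, mul_sub,
      sub_mul, mul_assoc, neg_mul, mul_neg, h1, h2, h3, zero_add, Nat.reduceAdd]
  match_scalars <;> ring

section
variable {c : ℕ → B} (h : Pol c) (θ s t : K)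
include h

lemma Pol.quad_sum :
    s • ((dd θ t c 0 - s • dd θ t c 1) * (dd θ (-s) c 0 + t • dd θ (-s) c 1)
      + (dd θ s c 0 + t • dd θ s c 1) * (dd θ (-t) c 0 - s • dd θ (-t) c 1))
    - t • ((dd θ t c 0 + s • dd θ t c 1) * (dd θ (-s) c 0 - t • dd θ (-s) c 1)
      + (dd θ s c 0 - t • dd θ s c 1) * (dd θ (-t) c 0 + s • dd θ (-t) c 1))
    + t • (quadForm θ t (dd θ (-s) c) + quadForm θ t (dd θ s c))
    - s • (quadForm θ s (dd θ t c) + quadForm θ s (dd θ (-t) c)) = 0 := by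
  have h1 := h.one 0
  have h2 := h.two 0
  have h3 := h.one 1
  have h4 := h.two 1
  have h5 := h.one 2
  have h6 := h.three 0
  simp only [zero_add, Nat.reduceAdd] at h1 h2 h3 h4 h5 h6
  simp only [dd, quadForm]
  simp only [smul_add, smul_sub, smul_neg, smul_mul_assoc, mul_smul_comm, add_mul, mul_add, mul_sub,
      sub_mul, mul_assoc, neg_mul, mul_neg, h1, h2, h3, h4, h5, h6, zero_add, Nat.reduceAdd]
  match_scalars <;> ring

lemma Pol.quadForm_dd : quadForm θ s (dd θ t c) = c 0 * c 0
    + ((2 + θ ^ 2) * t ^ 2 + s ^ 2 - θ ^ 2 * s * t) • (c 1 * c 1)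
    + (t ^ 4 + s ^ 2 * t ^ 2 * (2 + θ ^ 2) + s * θ ^ 2 * t ^ 3) • (c 2 * c 2)
    + (s ^ 2 * t ^ 4) • (c 3 * c 3)
    + (s * θ) • (c 0 * c 1 - (θ * t) • (c 0 * c 2) - (t ^ 2) • (c 0 * c 3)
      + ((θ ^ 2 + 1) * t ^ 2) • (c 1 * c 2) + (θ * t ^ 3) • (c 1 * c 3)
      + (t ^ 4) • (c 2 * c 3)) := by
  have h1 := h.one 0
  have h2 := h.two 0
  have h3 := h.one 1
  have h4 := h.two 1
  have h5 := h.one 2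
  have h6 := h.three 0
  simp only [zero_add, Nat.reduceAdd] at h1 h2 h3 h4 h5 h6
  simp only [dd, quadForm]
  simp only [smul_add, smul_sub, smul_neg, smul_mul_assoc, mul_smul_comm, add_mul, mul_add, mul_sub,
      sub_mul, mul_assoc, neg_mul, mul_neg, h1, h2, h3, h4, h5, h6, zero_add, Nat.reduceAdd]
  match_scalars <;> ring

lemma Pol.quadForm_mul : quadForm θ s (dd θ t c) * quadForm θ t (dd θ (-s) c)
    = quadForm θ t (dd θ s c) * quadForm θ s (dd θ (-t) c) := by
  rw [h.quadForm_dd, h.quadForm_dd, h.quadForm_dd, h.quadForm_dd]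
  have h1 := h.one 0
  have h2 := h.two 0
  have h3 := h.one 1
  have h4 := h.two 1
  have h5 := h.one 2
  have h6 := h.three 0
  simp only [zero_add, Nat.reduceAdd] at h1 h2 h3 h4 h5 h6
  generalize c 0 = c0 at *
  generalize c 1 = c1 at *
  generalize c 2 = c2 at *
  generalize c 3 = c3 at *
  have h1' : ∀ z, c1 * (c0 * z) = _ := fun z => by rw [← mul_assoc, h1]
  have h2' : ∀ z, c2 * (c0 * z) = _ := fun z => by rw [← mul_assoc, h2]
  have h3' : ∀ z, c2 * (c1 * z) = _ := fun z => by rw [← mul_assoc, h3]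
  have h4' : ∀ z, c3 * (c1 * z) = _ := fun z => by rw [← mul_assoc, h4]
  have h5' : ∀ z, c3 * (c2 * z) = _ := fun z => by rw [← mul_assoc, h5]
  have h6' : ∀ z, c3 * (c0 * z) = _ := fun z => by rw [← mul_assoc, h6]
  simp only [smul_add, smul_sub, smul_neg, smul_mul_assoc, mul_smul_comm, add_mul, mul_add, mul_sub,
      sub_mul, mul_assoc, neg_mul, mul_neg, h1, h2, h3, h4, h5, h6, h1', h2', h3', h4', h5', h6']
  match_scalars <;> ring

lemma Pol.comm_of_total {E H : B} {κ : K} (hE : ∀ j, E * dd θ s c j = dd θ (-s) c j * E)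
    (hH : ∀ j, H * dd θ t c j = dd θ (-t) c j * H) {lo lp lo' lp' k k' : B}
    (e1 : lo = θ • ((dd θ t c 0 - s • dd θ t c 1) * E))
    (e2 : lp = θ • ((dd θ t c 0 + s • dd θ t c 1) * E))
    (e3 : lo' = θ • ((dd θ s c 0 - t • dd θ s c 1) * H))
    (e4 : lp' = θ • ((dd θ s c 0 + t • dd θ s c 1) * H))
    (e5 : k = (s * θ) • (quadForm θ s (dd θ t c) * E))
    (e6 : k' = (t * θ) • (quadForm θ t (dd θ s c) * H))
    (T : s • (lo * lp' + lp' * lo) - t • (lp * lo' + lo' * lp) + θ • (E * k' + k' * E)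
      - θ • (k * H + H * k) + κ • (E * H - H * E) - κ • (k * k' - k' * k) = 0) :
    ∃ z w : B, κ • (E * H - H * E) + s • (z * (E * H - H * E)) + t • (w * (E * H - H * E)) = 0 := by
  subst e1 e2 e3 e4 e5 e6
  have hq1 := congrArg (· * (H * E)) (h.quad_sum θ s t)
  have hq2 := congrArg (· * (H * E)) (h.quadForm_mul θ s t)
  have hEB : E * quadForm θ t (dd θ s c) = quadForm θ t (dd θ (-s) c) * E := by
    simp only [quadForm, mul_add, add_mul, mul_smul_comm, smul_mul_assoc, ← mul_assoc, hE]
    simp only [mul_assoc, hE]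
  have hHA : H * quadForm θ s (dd θ t c) = quadForm θ s (dd θ (-t) c) * H := by
    simp only [quadForm, mul_add, add_mul, mul_smul_comm, smul_mul_assoc, ← mul_assoc, hH]
    simp only [mul_assoc, hH]
  have hE0 := hE 0
  have hE1 := hE 1
  have hH0 := hH 0
  have hH1 := hH 1
  refine ⟨(θ ^ 2) • ((dd θ t c 0 - s • dd θ t c 1) * (dd θ (-s) c 0 + t • dd θ (-s) c 1)
      - quadForm θ s (dd θ t c)) - (κ * t * θ ^ 2) • (quadForm θ s (dd θ t c)
        * quadForm θ t (dd θ (-s) c)),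
    (θ ^ 2) • (quadForm θ t (dd θ (-s) c) - (dd θ t c 0 + s • dd θ t c 1)
      * (dd θ (-s) c 0 - t • dd θ (-s) c 1)), ?_⟩
  generalize quadForm θ t (dd θ s c) = B2 at *
  generalize quadForm θ t (dd θ (-s) c) = B2' at *
  generalize quadForm θ s (dd θ t c) = A2 at *
  generalize quadForm θ s (dd θ (-t) c) = A2' at *
  generalize dd θ s c 0 = b0 at *
  generalize dd θ s c 1 = b1 at *
  generalize dd θ t c 0 = a0 at *
  generalize dd θ t c 1 = a1 at *
  generalize dd θ (-s) c 0 = b0' at *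
  generalize dd θ (-s) c 1 = b1' at *
  generalize dd θ (-t) c 0 = a0' at *
  generalize dd θ (-t) c 1 = a1' at *
  have r1 : ∀ z, E * (b0 * z) = _ := fun z => by rw [← mul_assoc, hE0]
  have r2 : ∀ z, E * (b1 * z) = _ := fun z => by rw [← mul_assoc, hE1]
  have r3 : ∀ z, E * (B2 * z) = _ := fun z => by rw [← mul_assoc, hEB]
  have r4 : ∀ z, H * (a0 * z) = _ := fun z => by rw [← mul_assoc, hH0]
  have r5 : ∀ z, H * (a1 * z) = _ := fun z => by rw [← mul_assoc, hH1]
  have r6 : ∀ z, H * (A2 * z) = _ := fun z => by rw [← mul_assoc, hHA]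
  linear_combination (norm := skip) T - (θ ^ 2) • hq1 + (κ * s * t * θ ^ 2) • hq2
  simp only [smul_add, smul_sub, smul_neg, smul_mul_assoc, mul_smul_comm, add_mul, mul_add, mul_sub,
      sub_mul, mul_assoc, neg_mul, mul_neg, hE0, hE1, hEB, hH0, hH1, hHA, r1, r2, r3, r4, r5, r6,
      mul_zero, zero_mul]
  match_scalars <;> ring

end
end Clifford
end AltData

namespace AltData

section Series
open PowerSeries

variable {R : Type*} [Ring R] [Algebra ℂ R]

/-- The scalars of `R`, as central elements. -/
def cst (R : Type*) [Ring R] [Algebra ℂ R] (z : ℂ) : Subring.center R :=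
  ⟨algebraMap ℂ R z, Subring.mem_center_iff.mpr fun g => (Algebra.commutes z g).symm⟩

/-- The power series variable, as a central element. -/
def var (R : Type*) [Ring R] : Subring.center R⟦X⟧ :=
  ⟨X, Subring.mem_center_iff.mpr fun g => commute_X g⟩

/-- The inner variable of an iterated power series ring, as a central element. -/
def innerVar (R : Type*) [Ring R] : Subring.center R⟦X⟧⟦X⟧ :=
  ⟨C X, Subring.mem_center_iff.mpr fun g => by
    ext1 n; rw [coeff_mul_C, coeff_C_mul]; exact commute_X _⟩

lemma cst_smul (z : ℂ) (r : R) : cst R z • r = z • r := by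
  rw [Subring.smul_def, smul_eq_mul, Algebra.smul_def]; rfl

lemma var_smul (φ : R⟦X⟧) : var R • φ = X * φ := rfl

lemma innerVar_smul (φ : R⟦X⟧⟦X⟧) : innerVar R • φ = C X * φ := rfl

lemma dd_eq {θ : ℂ} (x : Subring.center R) (c : ℕ → R) (j : ℕ) :
    dd (cst R θ) x c j = c j - θ • x • c (j + 1) - x • x • c (j + 2) := by
  rw [dd, mul_smul, cst_smul, mul_smul]

def fibPoly (θ : ℂ) : ℕ → ℂ
  | 0 => 1
  | 1 => θ
  | n + 2 => θ * fibPoly θ (n + 1) + fibPoly θ n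

/-- The series `∑ γᵢ w (a + i) xⁱ` with `∑ γᵢ xⁱ = 1 / (1 - θ x - x²)`. -/
def gen (θ : ℂ) (w : ℕ → R) (a : ℕ) : R⟦X⟧ := PowerSeries.mk fun i => fibPoly θ i • w (a + i)

lemma coeff_gen (θ : ℂ) (w : ℕ → R) (a i : ℕ) :
    coeff i (gen θ w a) = fibPoly θ i • w (a + i) := coeff_mk _ _

lemma dd_gen (θ : ℂ) (w : ℕ → R) (j : ℕ) :
    dd (cst R⟦X⟧ θ) (var R) (gen θ w) j = C (w j) := by
  rw [dd_eq]
  simp only [var_smul]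
  ext n
  match n with
  | 0 =>
    have : constantCoeff (gen θ w j) = w j := by
      rw [← coeff_zero_eq_constantCoeff_apply, coeff_gen]; simp [fibPoly]
    simp [this]
  | 1 => simp [coeff_gen, fibPoly, coeff_succ_X_mul, coeff_C]
  | n + 2 =>
    simp [coeff_gen, fibPoly, coeff_succ_X_mul, coeff_C]
    rw [show j + 1 + (n + 1) = j + (n + 2) by ring, show j + 2 + n = j + (n + 2) by ring]
    module

lemma Pol.gen {w : ℕ → R} (h : Pol w) (θ : ℂ) : Pol (gen θ w) := by
  intro i j
  ext n
  simp only [map_add, coeff_mul, coeff_gen, map_zero]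
  rw [← Finset.Nat.sum_antidiagonal_swap (f := fun p => fibPoly θ p.1 • w (j + p.1) * _),
    ← Finset.Nat.sum_antidiagonal_swap (f := fun p => fibPoly θ p.1 • w (j + 1 + p.1) * _),
    ← Finset.sum_add_distrib, ← Finset.sum_add_distrib, ← Finset.sum_add_distrib]
  refine Finset.sum_eq_zero fun p _ => ?_
  have := congrArg ((fibPoly θ p.1 * fibPoly θ p.2) • ·) (h (i + p.1) (j + p.2))
  simp only [smul_mul_assoc, mul_smul_comm, Prod.fst_swap, Prod.snd_swap]
  rw [show i + 1 + p.1 = i + p.1 + 1 by ring, show j + 1 + p.2 = j + p.2 + 1 by ring]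
  simp only [smul_zero] at this
  linear_combination (norm := module) this

lemma eq_zero_of_dd_eq_zero {θ : ℂ} {G : ℕ → R⟦X⟧}
    (h : ∀ j, dd (cst R⟦X⟧ θ) (var R) G j = 0) (j : ℕ) : G j = 0 := by
  ext n
  induction n using Nat.strong_induction_on generalizing j with
  | _ n ih =>
    have h1 := congrArg (coeff n) (h j)
    rw [dd_eq] at h1
    simp only [var_smul] at h1
    match n, ih with
    | 0, _ => simpa using h1
    | 1, ih =>
      have := ih 0 (by norm_num) (j + 1)
      simp [coeff_succ_X_mul, -coeff_zero_eq_constantCoeff] at h1 this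
      simpa [this] using h1
    | n + 2, ih =>
      have h2 := ih (n + 1) (by omega) (j + 1)
      have h3 := ih n (by omega) (j + 2)
      simp only [map_zero] at h2 h3
      simpa [coeff_succ_X_mul, h2, h3] using h1

/-- Exchange relations between the sequences `e` and `w`. -/
def Exch (θ : ℂ) (e : ℤ → R) (w : ℕ → R) : Prop := ∀ j a,
  e j * w a - w a * e j = θ • (e (j - 1) * w (a + 1) + w (a + 1) * e (j - 1))
    + (e (j - 2) * w (a + 2) - w (a + 2) * e (j - 2))

lemma Exch.const {θ : ℂ} {e : ℤ → R} {w : ℕ → R} (h : Exch θ e w) (h0 : ∀ j < 0, e j = 0)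
    (a : ℕ) : (PowerSeries.mk fun n => e n) * dd (cst R⟦X⟧ θ) (var R) (fun a => C (w a)) a
      = dd (cst R⟦X⟧ θ) (-var R) (fun a => C (w a)) a * PowerSeries.mk fun n => e n := by
  rw [dd_eq, dd_eq]
  simp only [var_smul, neg_smul, mul_sub, sub_mul, smul_neg, mul_neg, neg_mul, neg_neg,
    mul_smul_comm, smul_mul_assoc]
  ext n
  have h1 : ∀ φ ψ : R⟦X⟧, φ * (X * ψ) = X * (φ * ψ) := fun φ ψ => by
    rw [← mul_assoc, (commute_X φ).eq, mul_assoc]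
  simp only [h1, mul_assoc]
  have := h n a
  match n with
  | 0 =>
    rw [h0 _ (by norm_num : ((0 : ℕ) : ℤ) - 1 < 0),
      h0 _ (by norm_num : ((0 : ℕ) : ℤ) - 2 < 0)] at this
    simp at this ⊢
    linear_combination (norm := abel) this
  | 1 =>
    rw [h0 _ (by norm_num : ((1 : ℕ) : ℤ) - 2 < 0)] at this
    simp [coeff_succ_X_mul] at this ⊢
    linear_combination (norm := module) this
  | n + 2 =>
    rw [show ((n + 2 : ℕ) : ℤ) - 1 = (n + 1 : ℕ) by push_cast; ring,
      show ((n + 2 : ℕ) : ℤ) - 2 = n by push_cast; ring] at this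
    simp [coeff_succ_X_mul] at this ⊢
    linear_combination (norm := module) this

lemma Exch.gen {θ : ℂ} {e : ℤ → R} {w : ℕ → R} (h : Exch θ e w) (h0 : ∀ j < 0, e j = 0)
    (a : ℕ) : (PowerSeries.mk fun n => e n) * dd (cst R⟦X⟧ θ) (var R) (gen θ w) a
      = dd (cst R⟦X⟧ θ) (-var R) (gen θ w) a * PowerSeries.mk fun n => e n := by
  rw [← sub_eq_zero]
  refine eq_zero_of_dd_eq_zero (θ := θ) (G := fun a =>
    (PowerSeries.mk fun n => e n) * dd (cst R⟦X⟧ θ) (var R) (AltData.gen θ w) a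
      - dd (cst R⟦X⟧ θ) (-var R) (AltData.gen θ w) a * PowerSeries.mk fun n => e n) (fun j => ?_) a
  have h1 := h.const h0 j
  simp only [← dd_gen θ w] at h1
  rw [← sub_eq_zero] at h1
  rw [← h1]
  simp only [dd, mul_sub, sub_mul, mul_smul_comm, smul_mul_assoc, smul_sub]
  match_scalars <;> ring

lemma Exch.lift {θ : ℂ} {e : ℤ → R} {w : ℕ → R} (h : Exch θ e w) :
    Exch θ (fun j => C (e j)) (AltData.gen θ w) := by
  intro j a
  ext n
  have := congrArg (fibPoly θ n • ·) (h j (a + n))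
  simp only [map_sub, map_add, coeff_C_mul, coeff_mul_C, coeff_gen, coeff_smul,
    mul_smul_comm, smul_mul_assoc]
  rw [show a + 1 + n = a + n + 1 by ring, show a + 2 + n = a + n + 2 by ring]
  linear_combination (norm := module) this

lemma coeff_dd_innerVar {θ : ℂ} (c : ℕ → R⟦X⟧) (i j : ℕ) :
    coeff i (dd (cst R⟦X⟧⟦X⟧ θ) (innerVar R) (gen θ c) j)
      = fibPoly θ i • dd (cst R⟦X⟧ θ) (var R) c (j + i) := by
  rw [dd_eq, dd_eq]
  simp only [innerVar_smul, var_smul, map_sub, coeff_C_mul, coeff_gen, coeff_smul, mul_smul_comm,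
    smul_sub]
  rw [show j + 1 + i = j + i + 1 by ring, show j + 2 + i = j + i + 2 by ring]
  module

lemma coeff_dd_neg_innerVar {θ : ℂ} (c : ℕ → R⟦X⟧) (i j : ℕ) :
    coeff i (dd (cst R⟦X⟧⟦X⟧ θ) (-innerVar R) (gen θ c) j)
      = fibPoly θ i • dd (cst R⟦X⟧ θ) (-var R) c (j + i) := by
  rw [dd_eq, dd_eq]
  simp only [innerVar_smul, var_smul, map_sub, coeff_C_mul, coeff_gen, coeff_smul, mul_smul_comm,
    smul_sub, neg_smul, map_neg, smul_neg, mul_neg]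
  rw [show j + 1 + i = j + i + 1 by ring, show j + 2 + i = j + i + 2 by ring]
  module

lemma Exch.inner {θ : ℂ} {e : ℤ → R} {w : ℕ → R} (h : Exch θ e w) (h0 : ∀ j < 0, e j = 0)
    (a : ℕ) : (C (PowerSeries.mk fun n => e n) : R⟦X⟧⟦X⟧) * dd (cst R⟦X⟧⟦X⟧ θ) (innerVar R)
        (AltData.gen θ (AltData.gen θ w)) a
      = dd (cst R⟦X⟧⟦X⟧ θ) (-innerVar R) (AltData.gen θ (AltData.gen θ w)) a
        * C (PowerSeries.mk fun n => e n) := by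
  ext1 i
  rw [coeff_C_mul, coeff_mul_C, coeff_dd_innerVar, coeff_dd_neg_innerVar, mul_smul_comm,
    smul_mul_assoc, h.gen h0]

lemma dd_innerVar_gen (θ : ℂ) (w : ℕ → R) (j : ℕ) :
    dd (cst R⟦X⟧⟦X⟧ θ) (innerVar R) (gen θ (gen θ w)) j = map C (gen θ w j) := by
  ext1 i
  rw [coeff_dd_innerVar, dd_gen, coeff_map, coeff_gen]
  ext1 n
  rw [coeff_smul, coeff_C, coeff_C]
  split_ifs <;> simp

end Series
end AltData

namespace AltData

variable {A : Type*} [Ring A] [Algebra ℂ A] {q : ℂ} {d : AltData A q}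

variable (d) in
def anti (a b : ℕ) : A := d.y a * d.y b + d.y b * d.y a

lemma f1_anti (a b : ℕ) : d.f1 * d.anti a b - d.anti a b * d.f1
    = (2 : ℂ) • (d.anti (a + 1) b + d.anti a (b + 1)) := by
  simp only [anti, y_succ, smul_mul_assoc, mul_smul_comm, mul_sub, sub_mul, mul_assoc, mul_add,
    add_mul]
  module

lemma anti_comm (a b : ℕ) : d.anti a b = d.anti b a := add_comm _ _

lemma anti_step {a b : ℕ} (h : d.f1 * d.anti a b - d.anti a b * d.f1 = 0) :
    d.anti (a + 1) b + d.anti a (b + 1) = 0 := by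
  rw [f1_anti] at h
  exact (smul_eq_zero.mp h).resolve_left two_ne_zero

lemma f1_anti_eq_zero (g : Generic q) (n : ℕ) : ∀ a : ℕ,
    d.f1 * d.anti a (a + n) - d.anti a (a + n) * d.f1 = 0 := by
  have h0 : ∀ a, d.f1 * d.anti a a - d.anti a a * d.f1 = 0 := fun a => by
    have := D_eq_zero (d := d) g 1 a
    rw [D, f_one] at this
    simp only [anti, mul_add, add_mul]
    linear_combination (norm := abel) this + this
  induction n using Nat.twoStepInduction with
  | zero => exact h0
  | one =>
    intro a
    have h1 := anti_step (h0 a)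
    rw [anti_comm] at h1
    rw [eq_zero_of_add_self h1]
    simp
  | more n ih1 ih2 =>
    intro a
    have h1 := anti_step (ih2 a)
    rw [show a + (n + 2) = a + (n + 1) + 1 by ring, eq_neg_of_add_eq_zero_right h1, mul_neg,
      neg_mul, ← neg_sub_neg, neg_neg, neg_neg]
    have h2 := ih1 (a + 1)
    rw [show a + 1 + n = a + (n + 1) by ring] at h2
    rw [← neg_sub, h2, neg_zero]

lemma pol_y (g : Generic q) : Pol d.y := by
  intro i j
  change d.anti (i + 1) j + d.anti i (j + 1) = 0
  rcases le_total i j with h | h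
  · obtain ⟨n, rfl⟩ := Nat.exists_eq_add_of_le h
    exact anti_step (f1_anti_eq_zero g n i)
  · obtain ⟨n, rfl⟩ := Nat.exists_eq_add_of_le h
    rw [anti_comm, anti_comm (j + n), add_comm]
    exact anti_step (f1_anti_eq_zero g n j)

lemma exch_f_y (g : Generic q) : Exch (q - q⁻¹) d.f d.y := rel g

lemma Too_add (g : Generic q) (i j : ℕ) : d.Too i j = d.Too 0 (i + j) :=
  d.Too_eq (k := i + j) (fun n hn => (stage' g (i + j)).oo n hn.le) i j le_rfl

lemma Toe_add (g : Generic q) (i j : ℕ) : d.Toe i j = d.Toe 0 (i + j) :=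
  d.Toe_eq (k := i + j) (stage' g (i + j)).oe i j le_rfl

lemma Teo_add (g : Generic q) (i j : ℕ) : d.Teo i j = d.Teo 0 (i + j) :=
  d.Teo_eq (k := i + j) (stage' g (i + j)).eo i j le_rfl

lemma Tee_add (g : Generic q) (i j : ℕ) : d.Tee i j = d.Tee 0 (i + j) :=
  d.Tee_eq (k := i + j) (stage' g (i + j)).ee i j le_rfl

section
variable (g : Generic q) (n m : ℕ)
include g

lemma X_Teo : d.Xo n * d.Teo 0 m - d.Teo 0 m * d.Xo n
    = q • (d.Xe n * d.Too 0 m) + q⁻¹ • (d.Too 0 m * d.Xe n) := by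
  induction n with
  | zero => exact d.exch_X_Teo m
  | succ n ih =>
    have h1 := (stage' (d := d) g (m + 1)).oo m (by omega)
    have h2 := (stage' (d := d) g (m + 1)).eo m (by omega)
    have h := congrArg d.ad2 ih
    simp only [ad2_sub, ad2_add, ad2_smul, ad2_mul, h1, h2, ← Xo_shift, ← Xe_shift] at h
    simpa using h

lemma X_Tee : d.Xo n * d.Tee 0 m - d.Tee 0 m * d.Xo n
    = q • (d.Xe n * d.Toe 0 m) - q⁻¹ • (d.Toe 0 m * d.Xe n) := by
  induction n with
  | zero => exact d.exch_X_Tee m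
  | succ n ih =>
    have h1 := (stage' (d := d) g (m + 1)).oe m (by omega)
    have h2 := (stage' (d := d) g (m + 1)).ee m (by omega)
    have h := congrArg d.ad2 ih
    simp only [ad2_sub, ad2_add, ad2_smul, ad2_mul, h1, h2, ← Xo_shift, ← Xe_shift] at h
    simpa using h

lemma quad : d.Too 0 n * d.Tee 0 m + d.Tee 0 m * d.Too 0 n
      + q⁻¹ • (d.Toe 0 n * d.Teo 0 m) - q • (d.Teo 0 m * d.Toe 0 n)
      + q • (d.Teo 0 n * d.Toe 0 m) - q⁻¹ • (d.Toe 0 m * d.Teo 0 n)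
      - (d.Tee 0 n * d.Too 0 m + d.Too 0 m * d.Tee 0 n) = 0 := by
  have h3 := d.exch_Tee_Y m
  have h4 := d.exch_Toe_Y m
  rw [Tee_add g, Teo_add g] at h3
  rw [Toe_add g, Too_add g] at h4
  have h := quad_rel g.ne_zero (X_Tee (d := d) g n m) (X_Teo g n m) h3 h4
  have e1 := Too_add (d := d) g n 0
  have e2 := Toe_add (d := d) g n 0
  have e3 := Teo_add (d := d) g n 0
  have e4 := Tee_add (d := d) g n 0
  rw [Too] at e1
  rw [Toe] at e2
  rw [Teo] at e3
  rw [Tee] at e4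
  rw [e1, e2, e3, e4] at h
  exact h

end

section Series
open PowerSeries

variable (d) in
/-- Half the difference of the two even imaginary root vectors. -/
def kd : ℕ → A
  | 0 => 0
  | n + 1 => (2 : ℂ)⁻¹ • (d.Toe 0 n - d.Teo 0 n)

lemma kd_succ (n : ℕ) : d.kd (n + 1) = (2 : ℂ)⁻¹ • (d.Too 0 n * d.L + d.L * d.Too 0 n) := by
  rw [Too_L]; rfl

variable (d) in
def serE : A⟦X⟧ := PowerSeries.mk fun n => d.f n
variable (d) in
def serLo : A⟦X⟧ := PowerSeries.mk fun n => d.Too 0 n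
variable (d) in
def serLp : A⟦X⟧ := PowerSeries.mk fun n => d.Lp n
variable (d) in
def serK : A⟦X⟧ := PowerSeries.mk fun n => d.kd n

lemma serE_L (g : Generic q) (j : ℕ) : d.serE * C (d.y j)
    = dd (cst A⟦X⟧ (q - q⁻¹)) (-var A) (gen (q - q⁻¹) d.y) j * d.serE := by
  rw [← dd_gen (q - q⁻¹) d.y j]
  exact (exch_f_y g).gen (fun j => d.f_neg) j

lemma serLo_eq_aux (g : Generic q) : serLo d
    = (2 : ℂ)⁻¹ • ((q - q⁻¹) • (d.serE * C (d.y 0) + C (d.y 0) * d.serE)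
      + X * (d.serE * C (d.y 1) - C (d.y 1) * d.serE))
      - (2 : ℂ)⁻¹ • (d.serE * C (d.y 0) - C (d.y 0) * d.serE) := by
  ext n
  have h1 := d.Too_eq_ell (stage' g n) (n := n) (by omega)
  rw [d.ell_eq g (comm g n) (by omega)] at h1
  cases n with
  | zero =>
    rw [d.f_neg (by norm_num : ((0 : ℕ) : ℤ) - 1 < 0)] at h1
    simp [serLo, serE, h1, y_zero]
    module
  | succ n =>
    rw [show ((n + 1 : ℕ) : ℤ) - 1 = n by push_cast; ring] at h1
    simp [serLo, serE, h1, y_zero, coeff_succ_X_mul]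
    module

lemma serLp_eq_aux (g : Generic q) : serLp d
    = (2 : ℂ)⁻¹ • ((q - q⁻¹) • (d.serE * C (d.y 0) + C (d.y 0) * d.serE)
      + X * (d.serE * C (d.y 1) - C (d.y 1) * d.serE))
      + (2 : ℂ)⁻¹ • (d.serE * C (d.y 0) - C (d.y 0) * d.serE) := by
  ext n
  have h1 := d.Lp_eq_ell (stage' g n) (n := n) (by omega)
  rw [d.ell_eq g (comm g n) (by omega)] at h1
  cases n with
  | zero =>
    rw [d.f_neg (by norm_num : ((0 : ℕ) : ℤ) - 1 < 0)] at h1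
    simp [serLp, serE, h1, y_zero]
    module
  | succ n =>
    rw [show ((n + 1 : ℕ) : ℤ) - 1 = n by push_cast; ring] at h1
    simp [serLp, serE, h1, y_zero, coeff_succ_X_mul]
    module

lemma serK_eq_aux : serK d = X * (2 : ℂ)⁻¹ • (serLo d * C d.L + C d.L * serLo d) := by
  ext n
  cases n with
  | zero => simp [serK, kd]
  | succ n => simp [serK, coeff_succ_X_mul, kd_succ, serLo]

lemma serLo_eq (g : Generic q) : serLo d = cst A⟦X⟧ (q - q⁻¹) •
    ((gen (q - q⁻¹) d.y 0 - var A • gen (q - q⁻¹) d.y 1) * serE d) := by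
  rw [serLo_eq_aux g, serE_L g, serE_L g, ← dd_gen (q - q⁻¹), ← dd_gen (q - q⁻¹), dd_eq, dd_eq,
    dd_eq, dd_eq, cst_smul]
  simp only [neg_smul, smul_neg, var_smul, mul_add, mul_sub, add_mul, sub_mul, mul_assoc, neg_mul,
    mul_neg, smul_mul_assoc, mul_smul_comm]
  module

lemma serLp_eq (g : Generic q) : serLp d = cst A⟦X⟧ (q - q⁻¹) •
    ((gen (q - q⁻¹) d.y 0 + var A • gen (q - q⁻¹) d.y 1) * serE d) := by
  rw [serLp_eq_aux g, serE_L g, serE_L g, ← dd_gen (q - q⁻¹), ← dd_gen (q - q⁻¹), dd_eq, dd_eq,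
    dd_eq, dd_eq, cst_smul]
  simp only [neg_smul, smul_neg, var_smul, mul_add, mul_sub, add_mul, sub_mul, mul_assoc, neg_mul,
    mul_neg, smul_mul_assoc, mul_smul_comm]
  module

lemma serK_eq (g : Generic q) : serK d = (var A * cst A⟦X⟧ (q - q⁻¹)) •
    (quadForm (cst A⟦X⟧ (q - q⁻¹)) (var A) (gen (q - q⁻¹) d.y) * serE d) := by
  have h := ((pol_y (d := d) g).gen (q - q⁻¹)).quad (cst A⟦X⟧ (q - q⁻¹)) (var A)
  have h2 := serE_L (d := d) g 0
  rw [dd_gen] at h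
  have h3 := congrArg (· * serE d) h
  rw [serK_eq_aux, serLo_eq g, mul_smul, cst_smul, cst_smul, ← var_smul, ← y_zero]
  simp only [smul_mul_assoc, mul_smul_comm, mul_assoc, h2]
  simp only [two_smul, mul_assoc, add_mul, ← smul_add] at h3 ⊢
  rw [h3, smul_comm (var A), smul_comm (2 : ℂ)⁻¹, ← two_smul ℂ (_ * serE d)]
  congr 1
  module

end Series

end AltData

namespace AltData

section Double
open PowerSeries

section
variable {R : Type*} [Ring R] [Algebra ℂ R]

lemma map_C_cst (z : ℂ) (φ : R⟦X⟧) :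
    map (C (R := R)) (cst R⟦X⟧ z • φ) = cst R⟦X⟧⟦X⟧ z • map C φ := by
  rw [cst_smul, cst_smul]; ext1 n; simp only [coeff_map, coeff_smul]
  ext1 m; rw [coeff_smul, coeff_C, coeff_C]; split_ifs <;> simp

lemma map_C_var (φ : R⟦X⟧) :
    map (C (R := R)) (var R • φ) = var R⟦X⟧ • map C φ := by
  rw [var_smul, var_smul, map_mul, map_X]

lemma C_cst (z : ℂ) (φ : R⟦X⟧) :
    (C (cst R⟦X⟧ z • φ) : R⟦X⟧⟦X⟧) = cst R⟦X⟧⟦X⟧ z • C φ := by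
  rw [cst_smul, cst_smul]
  ext1 m; rw [coeff_smul, coeff_C, coeff_C]; split_ifs <;> simp

lemma C_var (φ : R⟦X⟧) : (C (var R • φ) : R⟦X⟧⟦X⟧) = innerVar R • C φ := by
  rw [var_smul, innerVar_smul, map_mul]

lemma map_C_quadForm (θ : ℂ) (a : ℕ → R⟦X⟧) :
    map (C (R := R)) (quadForm (cst R⟦X⟧ θ) (var R) a)
      = quadForm (cst R⟦X⟧⟦X⟧ θ) (var R⟦X⟧) fun j => map C (a j) := by
  simp only [quadForm, map_add, map_mul, mul_smul, map_C_cst, map_C_var]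

lemma C_quadForm (θ : ℂ) (a : ℕ → R⟦X⟧) :
    (C (quadForm (cst R⟦X⟧ θ) (var R) a) : R⟦X⟧⟦X⟧)
      = quadForm (cst R⟦X⟧⟦X⟧ θ) (innerVar R) fun j => C (a j) := by
  simp only [quadForm, map_add, map_mul, mul_smul, C_cst, C_var]

lemma coeff_map_mul_C (φ ψ : R⟦X⟧) (i j : ℕ) :
    coeff j (coeff i (map (C (R := R)) φ * C ψ)) = coeff i φ * coeff j ψ := by
  rw [coeff_mul_C, coeff_map, coeff_C_mul]

lemma coeff_C_mul_map (φ ψ : R⟦X⟧) (i j : ℕ) :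
    coeff j (coeff i (C ψ * map (C (R := R)) φ)) = coeff j ψ * coeff i φ := by
  rw [coeff_C_mul, coeff_map, coeff_mul_C]

lemma coeff_var_zero (φ : R⟦X⟧⟦X⟧) (j : ℕ) : coeff j (coeff 0 (var R⟦X⟧ • φ)) = 0 := by
  rw [var_smul, coeff_zero_X_mul, map_zero]

lemma coeff_var_succ (φ : R⟦X⟧⟦X⟧) (i j : ℕ) :
    coeff j (coeff (i + 1) (var R⟦X⟧ • φ)) = coeff j (coeff i φ) := by
  rw [var_smul, coeff_succ_X_mul]

lemma coeff_innerVar_zero (φ : R⟦X⟧⟦X⟧) (i : ℕ) : coeff 0 (coeff i (innerVar R • φ)) = 0 := by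
  rw [innerVar_smul, coeff_C_mul, coeff_zero_X_mul]

lemma coeff_innerVar_succ (φ : R⟦X⟧⟦X⟧) (i j : ℕ) :
    coeff (j + 1) (coeff i (innerVar R • φ)) = coeff j (coeff i φ) := by
  rw [innerVar_smul, coeff_C_mul, coeff_succ_X_mul]

lemma coeff_cst (z : ℂ) (φ : R⟦X⟧⟦X⟧) (i j : ℕ) :
    coeff j (coeff i (cst R⟦X⟧⟦X⟧ z • φ)) = z • coeff j (coeff i φ) := by
  rw [cst_smul]; rfl

/-- A double power series which is a multiple of itself by terms of positive order vanishes. -/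
lemma eq_zero_of_self_smul {z : ℂ} (hz : z ≠ 0) {φ u v : R⟦X⟧⟦X⟧}
    (h : cst R⟦X⟧⟦X⟧ z • φ + var R⟦X⟧ • (u * φ) + innerVar R • (v * φ) = 0) : φ = 0 := by
  suffices H : ∀ n i j, i + j = n → coeff j (coeff i φ) = 0 by
    ext i j; exact H _ i j rfl
  intro n
  induction n using Nat.strong_induction_on with
  | _ n ih =>
    have hmul : ∀ (w : R⟦X⟧⟦X⟧) i j, i + j < n → coeff j (coeff i (w * φ)) = 0 := by
      intro w i j hij
      rw [coeff_mul, map_sum]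
      refine Finset.sum_eq_zero fun p hp => ?_
      rw [coeff_mul]
      refine Finset.sum_eq_zero fun r hr => ?_
      rw [Finset.HasAntidiagonal.mem_antidiagonal] at hp hr
      rw [ih _ (by omega : p.2 + r.2 < n) _ _ rfl, mul_zero]
    intro i j hij
    have h1 := congrArg (fun ψ => coeff j (coeff i ψ)) h
    simp only [map_add, coeff_cst, map_zero] at h1
    have h2 : coeff j (coeff i (var R⟦X⟧ • (u * φ))) = 0 := by
      cases i with
      | zero => exact coeff_var_zero _ _
      | succ i => rw [coeff_var_succ]; exact hmul _ _ _ (by omega)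
    have h3 : coeff j (coeff i (innerVar R • (v * φ))) = 0 := by
      cases j with
      | zero => exact coeff_innerVar_zero _ _
      | succ j => rw [coeff_innerVar_succ]; exact hmul _ _ _ (by omega)
    rw [h2, h3, add_zero, add_zero] at h1
    exact (smul_eq_zero.mp h1).resolve_left hz

end

variable {A : Type*} [Ring A] [Algebra ℂ A] {q : ℂ} {d : AltData A q}

lemma f_succ_eq (n : ℕ) : d.Toe 0 n = d.f (n + 1 : ℕ) + d.kd (n + 1) := by
  rw [Nat.cast_succ, f_succ, kd]; module

lemma f_succ_eq' (n : ℕ) : d.Teo 0 n = d.f (n + 1 : ℕ) - d.kd (n + 1) := by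
  rw [Nat.cast_succ, f_succ, kd]; module

lemma kd_zero : d.kd 0 = 0 := rfl

lemma total (g : Generic q) :
    var A⟦X⟧ • (map C d.serLo * C d.serLp + C d.serLp * map C d.serLo)
      - innerVar A • (map C d.serLp * C d.serLo + C d.serLo * map C d.serLp)
      + cst A⟦X⟧⟦X⟧ (q - q⁻¹) • (map C d.serE * C d.serK + C d.serK * map C d.serE)
      - cst A⟦X⟧⟦X⟧ (q - q⁻¹) • (map C d.serK * C d.serE + C d.serE * map C d.serK)
      + cst A⟦X⟧⟦X⟧ (q + q⁻¹) • (map C d.serE * C d.serE - C d.serE * map C d.serE)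
      - cst A⟦X⟧⟦X⟧ (q + q⁻¹) • (map C d.serK * C d.serK - C d.serK * map C d.serK) = 0 := by
  have ht := g.theta_ne
  ext i j
  simp only [map_sub, map_add, coeff_cst, coeff_map_mul_C, coeff_C_mul_map]
  cases i <;> cases j <;>
    simp only [coeff_var_zero, coeff_var_succ, coeff_innerVar_zero, coeff_innerVar_succ, map_add,
      coeff_map_mul_C, coeff_C_mul_map, serE, serLo, serLp, serK, coeff_mk, kd_zero, Nat.cast_zero, f_zero_mul,

      mul_f_zero, Lp, Too_zero, map_zero, mul_zero, zero_mul]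
  · simp
  · rw [kd_succ]
    generalize q - q⁻¹ = t at ht ⊢
    match_scalars <;> field_simp <;> ring
  · rw [kd_succ]
    generalize q - q⁻¹ = t at ht ⊢
    match_scalars <;> field_simp <;> ring
  · rename_i n m
    have h := quad (d := d) g n m
    rw [f_succ_eq, f_succ_eq, f_succ_eq', f_succ_eq'] at h
    linear_combination (norm := skip) h
    simp only [smul_add, smul_sub, mul_add, mul_sub, add_mul, sub_mul]
    module

/-- The even imaginary root vectors commute. -/
lemma f_comm_f (g : Generic q) (i j : ℕ) : d.f i * d.f j = d.f j * d.f i := by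
  set θ := q - q⁻¹ with hθ
  have e1 : ∀ j, dd (cst A⟦X⟧⟦X⟧ θ) (var A⟦X⟧) (gen θ (gen θ d.y)) j = C (gen θ d.y j) :=
    dd_gen θ _
  have e2 := dd_innerVar_gen θ d.y
  have hE := ((exch_f_y (d := d) g).lift).gen (fun j hj => by rw [d.f_neg hj, map_zero])
  have hH := (exch_f_y (d := d) g).inner (fun j hj => d.f_neg hj)
  have hE' : (PowerSeries.mk fun n => C (d.f (n : ℕ))) = map (C (R := A)) d.serE := by
    ext1 n; simp [serE]
  rw [hE'] at hE
  have l1 := congrArg (map (C (R := A))) (serLo_eq (d := d) g)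
  have l2 := congrArg (map (C (R := A))) (serLp_eq (d := d) g)
  have l3 := congrArg (C (R := A⟦X⟧)) (serLo_eq (d := d) g)
  have l4 := congrArg (C (R := A⟦X⟧)) (serLp_eq (d := d) g)
  have l5 := congrArg (map (C (R := A))) (serK_eq (d := d) g)
  have l6 := congrArg (C (R := A⟦X⟧)) (serK_eq (d := d) g)
  simp only [map_C_cst, map_C_var, map_mul, map_sub, map_add, mul_smul, map_C_quadForm, C_cst, C_var,
    C_quadForm, ← hθ] at l1 l2 l3 l4 l5 l6
  obtain ⟨z, w, h⟩ := (((pol_y (d := d) g).gen θ).gen θ).comm_of_total (cst A⟦X⟧⟦X⟧ θ) (var A⟦X⟧)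
    (innerVar A) hE hH (by rw [e2, e2]; exact l1) (by rw [e2, e2]; exact l2)
    (by rw [e1, e1]; exact l3) (by rw [e1, e1]; exact l4)
    (by rw [funext e2, mul_smul]; exact l5) (by rw [funext e1, mul_smul]; exact l6) (total g)
  have h2 := congrArg (fun ψ => coeff j (coeff i ψ)) (eq_zero_of_self_smul g.two_ne h)
  change coeff j (coeff i (map C d.serE * C d.serE - C d.serE * map C d.serE)) = _ at h2
  simp only [map_sub, map_zero, coeff_map_mul_C, coeff_C_mul_map] at h2
  simpa [serE, sub_eq_zero] using h2

end Double
end AltData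

namespace AltData

section Exponential
open PowerSeries

variable {R : Type*} [Ring R] [Algebra ℂ R]

lemma sum_composition_succ (F : List ℕ → R) (n : ℕ) : ∑ c : Composition (n + 1), F c.blocks
    = ∑ p ∈ Finset.HasAntidiagonal.antidiagonal n, ∑ c : Composition p.2, F ((p.1 + 1) :: c.blocks) := by
  rw [Finset.sum_sigma']
  symm
  refine Finset.sum_bij (fun x hx => (⟨(x.1.1 + 1) :: x.2.blocks, fun {i} hi => ?_, ?_⟩ :
    Composition (n + 1))) ?_ ?_ ?_ ?_
  · rcases List.mem_cons.mp hi with rfl | hi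
    exacts [Nat.succ_pos _, x.2.blocks_pos hi]
  · have := Finset.HasAntidiagonal.mem_antidiagonal.mp (Finset.mem_sigma.mp hx).1
    rw [List.sum_cons, x.2.blocks_sum]; omega
  · simp
  · rintro ⟨⟨a, b⟩, c⟩ hx ⟨⟨a', b'⟩, c'⟩ hx' h
    have h1 := Finset.HasAntidiagonal.mem_antidiagonal.mp (Finset.mem_sigma.mp hx).1
    have h2 := Finset.HasAntidiagonal.mem_antidiagonal.mp (Finset.mem_sigma.mp hx').1
    simp only [Composition.mk.injEq, List.cons.injEq, add_left_inj] at h h1 h2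
    obtain ⟨rfl, h3⟩ := h
    obtain rfl : b = b' := by omega
    obtain rfl : c = c' := Composition.ext h3
    rfl
  · intro c _
    obtain ⟨i, l, hl⟩ : ∃ i l, c.blocks = i :: l :=
      List.exists_cons_of_ne_nil fun h => by simp [Composition.blocks_eq_nil] at h
    have hs := c.blocks_sum
    have hi := c.blocks_pos (i := i) (by rw [hl]; simp)
    rw [hl, List.sum_cons] at hs
    refine ⟨⟨(i - 1, n + 1 - i), ⟨l, fun {j} hj => c.blocks_pos (by rw [hl]; simp [hj]), ?_⟩⟩, ?_, ?_⟩
    · change l.sum = n + 1 - i; omega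
    · rw [Finset.mem_sigma]
      refine ⟨?_, Finset.mem_univ _⟩
      rw [Finset.HasAntidiagonal.mem_antidiagonal]
      change i - 1 + (n + 1 - i) = n
      omega
    · refine Composition.ext ?_
      change (i - 1 + 1) :: l = c.blocks
      rw [hl, Nat.sub_add_cancel hi]
  · intros; rfl

/-- The power series without constant term with coefficients `a 1, a 2, …`. -/
def ser (a : ℕ → R) : R⟦X⟧ := X * PowerSeries.mk fun n => a (n + 1)

lemma coeff_succ_ser_mul (a : ℕ → R) (φ : R⟦X⟧) (n : ℕ) : coeff (n + 1) (ser a * φ)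
    = ∑ p ∈ Finset.HasAntidiagonal.antidiagonal n, a (p.1 + 1) * coeff p.2 φ := by
  rw [ser, mul_assoc, coeff_succ_X_mul, coeff_mul]
  simp only [coeff_mk]

lemma coeff_zero_ser_mul (a : ℕ → R) (φ : R⟦X⟧) : coeff 0 (ser a * φ) = 0 := by
  rw [ser, mul_assoc, coeff_zero_X_mul]

lemma sum_composition (a : ℕ → R) (n : ℕ) : ∀ (φ : ℕ → ℂ) (N : ℕ), n < N →
    ∑ c : Composition n, φ c.length • (c.blocks.map a).prod
      = ∑ k ∈ Finset.range N, φ k • coeff n (ser a ^ k) := by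
  induction n using Nat.strong_induction_on with
  | _ n ih =>
    intro φ N hN
    obtain ⟨N, rfl⟩ : ∃ M, N = M + 1 := ⟨N - 1, by omega⟩
    rw [Finset.sum_range_succ']
    simp only [pow_succ', pow_zero]
    cases n with
    | zero =>
      simp only [coeff_zero_ser_mul, smul_zero, Finset.sum_const_zero, zero_add]
      have hc : ∀ c : Composition 0, φ c.length • (c.blocks.map a).prod = φ 0 • 1 := fun c => by
        rw [← Composition.blocks_length, (Composition.blocks_eq_nil c).mpr rfl]; rfl
      simp [hc, composition_card]
    | succ n =>
      simp only [← Composition.blocks_length]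
      rw [sum_composition_succ (fun l => φ l.length • (l.map a).prod)]
      simp only [coeff_succ_ser_mul, coeff_one, Nat.succ_ne_zero, if_false, smul_zero, add_zero,
        List.length_cons, List.map_cons, List.prod_cons, Finset.smul_sum]
      rw [Finset.sum_comm]
      refine Finset.sum_congr rfl fun p hp => ?_
      have hp := Finset.HasAntidiagonal.mem_antidiagonal.mp hp
      have := ih p.2 (by omega) (fun k => φ (k + 1)) N (by omega)
      simp only [← mul_smul_comm, ← Finset.mul_sum]
      rw [← this]

variable (R) in
/-- The Euler derivation: multiplication of the `n`th coefficient by `n`. -/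
def euler : R⟦X⟧ →ₗ[ℂ] R⟦X⟧ where
  toFun φ := PowerSeries.mk fun n => (n : ℂ) • coeff n φ
  map_add' φ ψ := by ext; simp
  map_smul' z φ := by ext; simp [smul_comm z]

lemma coeff_euler (φ : R⟦X⟧) (n : ℕ) : coeff n (euler R φ) = (n : ℂ) • coeff n φ := by
  simp [euler]

lemma euler_mul (φ ψ : R⟦X⟧) : euler R (φ * ψ) = euler R φ * ψ + φ * euler R ψ := by
  ext n
  simp only [coeff_euler, coeff_mul, map_add, Finset.smul_sum, ← Finset.sum_add_distrib]
  refine Finset.sum_congr rfl fun p hp => ?_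
  rw [← Finset.HasAntidiagonal.mem_antidiagonal.mp hp, smul_mul_assoc, mul_smul_comm, Nat.cast_add, add_smul]

lemma euler_pow {φ : R⟦X⟧} (h : Commute φ (euler R φ)) (n : ℕ) :
    euler R (φ ^ (n + 1)) = ((n + 1 : ℕ) : ℂ) • (φ ^ n * euler R φ) := by
  induction n with
  | zero => simp
  | succ n ih =>
    rw [pow_succ, euler_mul, ih, smul_mul_assoc, mul_assoc, ← h.eq, ← mul_assoc, ← pow_succ]
    push_cast
    module

section
variable {θ : ℂ} {f a : ℕ → R} (hθ : θ ≠ 0) (hf0 : θ • f 0 = 1)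
  (hf : ∀ n, 1 ≤ n → θ • f n = ∑ c : Composition n,
    (θ ^ c.length / (Nat.factorial c.length : ℂ)) • (c.blocks.map a).prod)
include hθ hf

/-- Whatever commutes with the coefficients of an exponential commutes with those of the
exponent. -/
lemma commute_of_exp {w : R} (hw : ∀ n, w * f n = f n * w) (n : ℕ) (hn : 1 ≤ n) :
    w * a n = a n * w := by
  induction n using Nat.strong_induction_on with
  | _ n ih =>
    obtain ⟨n, rfl⟩ : ∃ m, n = m + 1 := ⟨n - 1, by omega⟩
    have h := hf (n + 1) hn
    simp only [← Composition.blocks_length] at h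
    rw [sum_composition_succ
      (fun l => (θ ^ l.length / (Nat.factorial l.length : ℂ)) • (l.map a).prod)] at h
    have h1 : w * (θ • f (n + 1)) - (θ • f (n + 1)) * w = 0 := by
      rw [mul_smul_comm, hw, smul_mul_assoc, sub_self]
    rw [h, Finset.mul_sum, Finset.sum_mul, ← Finset.sum_sub_distrib,
      Finset.sum_eq_single (n, 0)] at h1
    · have hc : ∀ c : Composition 0, c.blocks = [] :=
        fun c => (Composition.blocks_eq_nil c).mpr rfl
      simp [hc, composition_card, ← smul_sub, hθ, sub_eq_zero] at h1
      exact h1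
    · intro p hp hp'
      have hp := Finset.HasAntidiagonal.mem_antidiagonal.mp hp
      have hlt : p.1 < n := by
        refine lt_of_le_of_ne (by omega) fun h => hp' ?_
        exact Prod.ext h (by omega)
      rw [sub_eq_zero]
      refine Commute.sum_right _ _ _ fun c _ => Commute.smul_right ?_ _
      refine Commute.list_prod_right _ _ fun x hx => ?_
      obtain ⟨i, hi, rfl⟩ := List.mem_map.mp hx
      rcases List.mem_cons.mp hi with rfl | hi
      · exact ih _ (by omega) (by omega)
      · exact ih _ (by have := c.blocks_le hi; omega) (c.one_le_blocks hi)
    · intro h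
      exact (h (Finset.HasAntidiagonal.mem_antidiagonal.mpr rfl)).elim

lemma smul_eq_sum_coeff_pow (hf0 : θ • f 0 = 1) {n N : ℕ} (h : n < N) : θ • f n
    = ∑ k ∈ Finset.range N, (θ ^ k / (Nat.factorial k : ℂ)) • coeff n (ser a ^ k) := by
  rw [← sum_composition a n (fun k => θ ^ k / (Nat.factorial k : ℂ)) N h]
  rcases Nat.eq_zero_or_pos n with rfl | hn
  · have hc : ∀ c : Composition 0, (θ ^ c.length / (Nat.factorial c.length : ℂ))
        • (c.blocks.map a).prod = 1 := fun c => by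
      rw [← Composition.blocks_length, (Composition.blocks_eq_nil c).mpr rfl]; simp
    simp [hc, hf0, composition_card]
  · exact hf n hn

lemma euler_exp (hf0 : θ • f 0 = 1) (h : Commute (ser a) (euler R (ser a))) :
    euler R (PowerSeries.mk f) = PowerSeries.mk f * (θ • euler R (ser a)) := by
  ext n
  have h1 := congrArg ((n : ℂ) • ·) (smul_eq_sum_coeff_pow hθ hf hf0 (show n < n + 1 + 1 by omega))
  rw [Finset.sum_range_succ'] at h1
  simp only [smul_add, Finset.smul_sum, pow_zero, coeff_one] at h1
  have h2 : ∀ k, (n : ℂ) • (θ ^ (k + 1) / (Nat.factorial (k + 1) : ℂ)) • coeff n (ser a ^ (k + 1))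
      = θ • (θ ^ k / (Nat.factorial k : ℂ)) • coeff n (ser a ^ k * euler R (ser a)) := fun k => by
    have h3 := congrArg (coeff n) (euler_pow h k)
    rw [coeff_euler, coeff_smul] at h3
    rw [smul_comm, h3, smul_smul, smul_smul]
    congr 1
    have : (Nat.factorial k : ℂ) ≠ 0 := by exact_mod_cast Nat.factorial_ne_zero k
    have : ((k + 1 : ℕ) : ℂ) ≠ 0 := by exact_mod_cast Nat.succ_ne_zero k
    rw [Nat.factorial_succ, Nat.cast_mul]
    field_simp
    ring
  have h4 : (n : ℂ) • (θ ^ 0 / (Nat.factorial 0 : ℂ)) • (if n = 0 then (1 : R) else 0) = 0 := by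
    split_ifs with h <;> simp [h]
  rw [Finset.sum_congr rfl fun k _ => h2 k, ← Finset.smul_sum, smul_comm] at h1
  simp only [pow_zero] at h4
  rw [h4, add_zero] at h1
  have h5 := smul_right_injective R hθ h1
  rw [coeff_euler, coeff_mk, h5]
  simp only [coeff_mul, coeff_mk, Finset.smul_sum]
  rw [Finset.sum_comm]
  refine Finset.sum_congr rfl fun p hp => ?_
  have hp := Finset.HasAntidiagonal.mem_antidiagonal.mp hp
  rw [coeff_smul, mul_smul_comm, ← smul_mul_assoc,
    smul_eq_sum_coeff_pow hθ hf hf0 (show p.1 < n + 1 by omega), Finset.sum_mul]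
  simp only [smul_mul_assoc]

end

end Exponential
end AltData

namespace AltData

section Log
open PowerSeries

lemma mul_dd_dd {K B : Type*} [CommRing K] [Ring B] [Algebra K B] {θ s : K} {E F : B} {W : ℕ → B}
    (hE : ∀ j, E * dd θ s W j = dd θ (-s) W j * E)
    (hF : ∀ j, E * (F * dd θ s W j - dd θ s W j * F)
      = ((θ * s) • W (j + 1) - (2 * (s * s)) • W (j + 2)) * E
        + E * ((θ * s) • W (j + 1) + (2 * (s * s)) • W (j + 2))) (j : ℕ) :
    E * (F * dd θ (-s) (dd θ s W) j - dd θ (-s) (dd θ s W) j * F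
      - ((2 * θ * s) • W (j + 1) + (2 * θ * s * s * s) • W (j + 3))) = 0 := by
  have h0 := hF j
  have h1 := congrArg ((θ * s) • ·) (hF (j + 1))
  have h2 := congrArg ((s * s) • ·) (hF (j + 2))
  have h3 := congrArg ((θ * s) • ·) (hE (j + 1))
  have h4 := congrArg ((2 * (s * s)) • ·) (hE (j + 2))
  simp only [dd, add_assoc, Nat.reduceAdd] at h0 h1 h2 h3 h4 ⊢
  linear_combination (norm := skip) h0 + h1 - h2 - h3 + h4
  simp only [mul_add, add_mul, mul_sub, sub_mul, mul_smul_comm, smul_mul_assoc, smul_sub, smul_add,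
    mul_assoc]
  match_scalars <;> ring

variable {R : Type*} [Ring R] [Algebra ℂ R]

lemma eq_zero_of_mul_eq_zero {f : ℕ → R} {θ : ℂ} (hf0 : θ • f 0 = 1) {φ : R⟦X⟧}
    (h : PowerSeries.mk f * φ = 0) : φ = 0 := by
  ext n
  induction n using Nat.strong_induction_on with
  | _ n ih =>
    have h1 := congrArg (θ • coeff n ·) h
    simp only [coeff_mul, coeff_mk, map_zero, smul_zero] at h1
    rw [Finset.sum_eq_single (0, n), ← smul_mul_assoc, hf0, one_mul] at h1
    · simpa using h1
    · intro p hp hp'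
      have hp := Finset.HasAntidiagonal.mem_antidiagonal.mp hp
      rw [ih p.2 ?_, map_zero, mul_zero]
      refine lt_of_le_of_ne (by omega) fun h => hp' ?_
      exact Prod.ext (by change p.1 = 0; omega) h
    · intro h
      exact (h (Finset.HasAntidiagonal.mem_antidiagonal.mpr (zero_add n))).elim

lemma eq_zero_of_dd_neg_eq_zero {θ : ℂ} {G : ℕ → R⟦X⟧}
    (h : ∀ j, dd (cst R⟦X⟧ θ) (-var R) G j = 0) (j : ℕ) : G j = 0 := by
  refine eq_zero_of_dd_eq_zero (θ := -θ) (fun j => ?_) j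
  rw [← h j, dd, dd, show cst R⟦X⟧ (-θ) = -cst R⟦X⟧ θ from Subtype.ext (map_neg _ _),
    neg_mul_neg, mul_neg, neg_mul]

/-- The coefficients of `2 θ (x + x³) / (1 - (2 + θ²) x² + x⁴)` for `θ = q - q⁻¹`. -/
def logCoeff (q : ℂ) (k : ℕ) : ℂ := (1 - (-1) ^ k) * (q ^ k - q⁻¹ ^ k)

lemma logCoeff_even (q : ℂ) (k : ℕ) : logCoeff q (2 * k) = 0 := by simp [logCoeff]

lemma logCoeff_odd (q : ℂ) (k : ℕ) : logCoeff q (2 * k + 1)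
    = 2 * (q ^ (2 * k + 1) - q⁻¹ ^ (2 * k + 1)) := by
  rw [logCoeff, Odd.neg_one_pow ⟨k, rfl⟩]; ring

def logSer (q : ℂ) (w : ℕ → R) (j : ℕ) : R⟦X⟧ := PowerSeries.mk fun k => logCoeff q k • w (j + k)

lemma dd_dd_logSer {q : ℂ} (hq : q ≠ 0) (w : ℕ → R) (j : ℕ) :
    dd (cst R⟦X⟧ (q - q⁻¹)) (-var R) (dd (cst R⟦X⟧ (q - q⁻¹)) (var R) (logSer q w)) j
      = (2 * cst R⟦X⟧ (q - q⁻¹) * var R) • C (w (j + 1))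
        + (2 * cst R⟦X⟧ (q - q⁻¹) * var R * var R * var R) • C (w (j + 3)) := by
  have h1 : dd (cst R⟦X⟧ (q - q⁻¹)) (-var R) (dd (cst R⟦X⟧ (q - q⁻¹)) (var R) (logSer q w)) j
    = logSer q w j - (2 + (q - q⁻¹) ^ 2) • (X * (X * logSer q w (j + 2)))
      + X * (X * (X * (X * logSer q w (j + 4)))) := by
    have h2 : cst R⟦X⟧ (2 + (q - q⁻¹) ^ 2) = 2 + cst R⟦X⟧ (q - q⁻¹) ^ 2 :=
      Subtype.ext (by simp [cst, map_ofNat]; rfl)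
    rw [← cst_smul, h2]
    simp only [← var_smul, dd, add_assoc, Nat.reduceAdd, smul_sub, smul_add]
    match_scalars <;> ring
  rw [h1]
  simp only [mul_smul, cst_smul, var_smul, two_mul, add_smul]
  have h3 : q * q⁻¹ = 1 := mul_inv_cancel₀ hq
  ext n
  match n with
  | 0 => simp [logSer, logCoeff]
  | 1 =>
    simp [logSer, logCoeff, coeff_succ_X_mul, coeff_C, coeff_X]
    module
  | 2 => simp [logSer, logCoeff, coeff_succ_X_mul, coeff_C, coeff_X]
  | 3 =>
    simp [logSer, logCoeff, coeff_succ_X_mul, coeff_C, coeff_X, add_assoc]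
    match_scalars
    field_simp
    ring
  | n + 4 =>
    simp [logSer, logCoeff, coeff_succ_X_mul, coeff_C, coeff_X]
    rw [show j + 2 + (n + 2) = j + (n + 4) by ring, show j + 4 + n = j + (n + 4) by ring]
    match_scalars
    field_simp
    ring

@[simp] lemma euler_X : euler R X = X := by
  ext n
  rw [coeff_euler, coeff_X]
  split_ifs with h <;> simp [h]

@[simp] lemma euler_C (r : R) : euler R (C r) = 0 := by
  ext n
  rw [coeff_euler, coeff_C]
  split_ifs with h <;> simp [h]

lemma euler_dd (θ : ℂ) (w : ℕ → R) (j : ℕ) :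
    euler R (dd (cst R⟦X⟧ θ) (var R) (fun a => C (w a)) j)
      = -((cst R⟦X⟧ θ * var R) • C (w (j + 1)) + (2 * (var R * var R)) • C (w (j + 2))) := by
  rw [dd_eq]
  simp only [var_smul, map_sub, map_smul, euler_mul, euler_C, euler_X, mul_zero, add_zero, two_mul,
    add_smul, mul_smul, cst_smul, mul_add]
  abel

lemma euler_dd_neg (θ : ℂ) (w : ℕ → R) (j : ℕ) :
    euler R (dd (cst R⟦X⟧ θ) (-var R) (fun a => C (w a)) j)
      = (cst R⟦X⟧ θ * var R) • C (w (j + 1)) - (2 * (var R * var R)) • C (w (j + 2)) := by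
  rw [dd_eq]
  simp only [neg_smul, smul_neg, neg_neg, var_smul, map_sub, map_neg, map_smul, euler_mul, euler_C,
    euler_X, mul_zero, add_zero, two_mul, add_smul, mul_smul, cst_smul, mul_add]
  abel

lemma comm_log {q : ℂ} (hq : q ≠ 0) {e : ℤ → R} {w a : ℕ → R} (hθ : q - q⁻¹ ≠ 0)
    (h : Exch (q - q⁻¹) e w) (h0 : ∀ j < 0, e j = 0) (he : (q - q⁻¹) • e 0 = 1)
    (hc : ∀ i j : ℕ, e i * e j = e j * e i)
    (hf : ∀ n : ℕ, 1 ≤ n → (q - q⁻¹) • e n = ∑ c : Composition n,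
      ((q - q⁻¹) ^ c.length / (Nat.factorial c.length : ℂ)) • (c.blocks.map a).prod)
    (k j : ℕ) : ((q - q⁻¹) * ((k + 1 : ℕ) : ℂ)) • (a (k + 1) * w j - w j * a (k + 1))
      = logCoeff q (k + 1) • w (j + (k + 1)) := by
  have ha : ∀ i j : ℕ, 1 ≤ i → 1 ≤ j → a i * a j = a j * a i := fun i j hi hj =>
    commute_of_exp hθ (f := fun n => e n) hf (fun m =>
      (commute_of_exp hθ (f := fun n => e n) hf (fun n => hc m n) i hi).symm) j hj
  have hser : Commute (ser a) (euler R (ser a)) := by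
    have h2 : ∀ n, coeff n (ser a) = if n = 0 then 0 else a n := by
      rintro (_ | n)
      · simp [ser]
      · simp [ser, coeff_succ_X_mul]
    change _ = _
    ext n
    rw [coeff_mul, coeff_mul, ← Finset.Nat.sum_antidiagonal_swap]
    refine Finset.sum_congr rfl fun p _ => ?_
    simp only [coeff_euler, h2, Prod.fst_swap, Prod.snd_swap, mul_smul_comm, smul_mul_assoc]
    split_ifs
    any_goals simp
    rw [ha p.1 p.2 (by omega) (by omega)]
  have hE := h.const h0
  have hD := euler_exp (f := fun n => e n) hθ hf he hser
  set E : R⟦X⟧ := PowerSeries.mk fun n => e n with hEdef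
  set F : R⟦X⟧ := (q - q⁻¹) • euler R (ser a) with hFdef
  have h1 := mul_dd_dd (F := F) hE (fun j => by
    have h2 := congrArg (euler R) (hE j)
    rw [euler_mul, euler_mul, hD, euler_dd, euler_dd_neg] at h2
    have h3 := congrArg (· * F) (hE j)
    simp only [mul_assoc] at h2 h3
    linear_combination (norm := skip) h2 - h3
    simp only [mul_add, mul_sub, mul_neg]
    abel)
  let G : ℕ → R⟦X⟧ := fun j => F * C (w j) - C (w j) * F - logSer q w j
  have hG : ∀ j, G j = 0 := by
    refine eq_zero_of_dd_eq_zero (θ := q - q⁻¹) fun j => ?_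
    refine eq_zero_of_dd_neg_eq_zero (θ := q - q⁻¹)
      (G := dd (cst R⟦X⟧ (q - q⁻¹)) (var R) G) (fun j => ?_) j
    refine eq_zero_of_mul_eq_zero (f := fun n => e n) he ?_
    have h2 := h1 j
    rw [← dd_dd_logSer hq] at h2
    rw [← hEdef, ← h2]
    congr 1
    simp only [G, dd, mul_sub, sub_mul, mul_smul_comm, smul_mul_assoc, smul_sub]
    abel
  have h2 := congrArg (coeff (k + 1)) (hG j)
  simp only [G, hFdef, logSer, map_sub, coeff_mul_C, coeff_C_mul, coeff_smul, coeff_euler, coeff_mk,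
    ser, coeff_succ_X_mul, map_zero] at h2
  rw [← sub_eq_zero, ← h2]
  simp only [mul_smul_comm, smul_mul_assoc, mul_smul, smul_sub]

end Log
end AltData

namespace AltData

variable {A : Type*} [Ring A] [Algebra ℂ A] {q : ℂ} {d : AltData A q}

lemma ad2_y_eq_zero (g : Generic q) (n : ℕ) : d.ad2 (d.y n) = 0 := by
  induction n with
  | zero => rw [y_zero, ad2_L]
  | succ n ih => simp [y_succ, ad2_smul, ad2_sub, ad2_mul, ih, d.ad2_f1 g]

lemma smul_y_succ (g : Generic q) (n : ℕ) : (2 : ℂ) • d.y (n + 1)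
    = d.Toe 0 0 * d.y n - d.y n * d.Toe 0 0 := by
  have h := ad2_y_eq_zero (d := d) g n
  rw [ad2] at h
  rw [y_succ, smul_smul, mul_inv_cancel₀ two_ne_zero, one_smul, Toe_zero]
  linear_combination (norm := noncomm_ring) h

theorem comm_log_L (g : Generic q) {a : ℕ → A}
    (ha : ∀ n : ℕ, 1 ≤ n → (q - q⁻¹) • d.f n = ∑ c : Composition n,
      ((q - q⁻¹) ^ c.length / (Nat.factorial c.length : ℂ)) • (c.blocks.map a).prod) (k : ℕ) :
    ((q - q⁻¹) * ((k + 1 : ℕ) : ℂ)) • (a (k + 1) * d.L - d.L * a (k + 1))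
      = logCoeff q (k + 1) • d.y (k + 1) := by
  have h0 : (q - q⁻¹) • d.f 0 = 1 := by
    rw [f_zero, smul_smul, mul_inv_cancel₀ g.theta_ne, one_smul]
  have := comm_log g.ne_zero g.theta_ne (exch_f_y g) (fun j => d.f_neg) h0 (f_comm_f g) ha k 0
  rwa [y_zero, zero_add] at this

end AltData

open QAff

lemma QAff.sub_neg_one_smul {q : ℂ} (u v : U q) : u - (-1 : ℂ) • v = u + v :=
  (congrArg (u - ·) (neg_one_smul ℂ v)).trans (sub_neg_eq_add u v)

lemma QAff.serreX_eq (q : ℂ) : X q 1 * X q 2 = q • (X q 2 * X q 1) := by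
  have h := RingQuot.mkAlgHom_rel ℂ (Rel.one (q := q))
  change π q (serre1 q) = π q 0 at h
  simp only [serre1, X2F, L1F, map_sub, map_mul, map_smul, map_zero] at h
  rw [sub_eq_zero] at h
  simpa only [X, L1U, pow_zero, one_smul] using h

lemma QAff.serreY_eq (q : ℂ) : Y q 2 * Y q 1 = q • (Y q 1 * Y q 2) := by
  have h := RingQuot.mkAlgHom_rel ℂ (Rel.two (q := q))
  change π q (serre2 q) = π q 0 at h
  simp only [serre2, Y2F, L1F, map_sub, map_add, map_mul, map_smul, map_zero] at h
  rw [sub_eq_zero] at h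
  simpa only [Y, L1U, zero_add, pow_one, sub_neg_one_smul] using h

/-- The root vectors of `U`, sorted by parity. -/
def QAff.altData {q : ℂ} (hq : q ≠ 0) : AltData (U q) q where
  Xo i := X q (2 * i + 1)
  Xe i := X q (2 * i + 2)
  Yo i := Y q (2 * i + 1)
  Ye i := Y q (2 * i + 2)
  L := L1U q
  q_ne := hq
  Xe_eq i := by rw [X, Even.neg_one_pow ⟨i, two_mul i⟩, one_smul]
  Xo_succ i := by
    rw [show 2 * (i + 1) + 1 = 2 * i + 1 + 2 by ring, X, Odd.neg_one_pow ⟨i, rfl⟩,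
      sub_neg_one_smul]
  Ye_eq i := by
    rw [Y, Odd.neg_one_pow ⟨i, rfl⟩,
      sub_neg_one_smul]
  Yo_succ i := by
    rw [show 2 * (i + 1) + 1 = 2 * i + 1 + 2 by ring, Y,
      Even.neg_one_pow ⟨i + 1, by ring⟩, one_smul]
  L_eq := rfl
  serreX := serreX_eq q
  serreY := serreY_eq q

section
variable {q : ℂ} (hq : q ≠ 0)

lemma QAff.Lt_two_mul (n : ℕ) : Lt q (2 * (n : ℤ)) = (altData hq).f n := by
  rw [Lt, if_pos (by positivity), show (2 * (n : ℤ)).toNat = 2 * n by omega]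
  cases n with
  | zero =>
    change (2 : ℂ)⁻¹ • (L q 0 + L' q 0) = (q - q⁻¹)⁻¹ • 1
    rw [L, L', θ, ← two_smul ℂ, smul_smul, inv_mul_cancel₀ two_ne_zero, one_smul]
  | succ n =>
    have h : L' q (2 * (n + 1)) = (altData hq).Teo 0 n := by
      rw [show 2 * (n + 1) = 2 * n + 2 by ring, L', Odd.neg_one_pow ⟨n, rfl⟩, mul_smul,
        sub_neg_one_smul]
      rfl
    rw [h]
    rfl

lemma QAff.M_eq (g : AltData.Generic q) (n : ℕ) : M q n = (2 : ℂ) ^ n • (altData hq).y n := by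
  induction n with
  | zero =>
    rw [pow_zero, one_smul, AltData.y_zero]
    rfl
  | succ n ih =>
    rw [M, ih, pow_succ, mul_smul, AltData.smul_y_succ g, mul_smul_comm, smul_mul_assoc]
    exact (smul_sub ((2 : ℂ) ^ n) (L q 2 * (altData hq).y n) ((altData hq).y n * L q 2)).symm

end

/-- In `U = U_q(A(0,2)^{(4)})^+`, where `Lbar j` denotes `L̄_{2j}`, the unique sequence with
`Σ_{n≥0} θL̃_{2n}u^{2n} = exp(Σ_{n≥1} θL̄_{2n}u^{2n})`, i.e.
`θL̃_{2n} = Σ_{k=1}^{n} (θᵏ/k!) Σ_{n₁+⋯+n_k=n, nᵢ≥1} L̄_{2n₁}⋯L̄_{2n_k}` for `n ≥ 1`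
(the inner sum runs over compositions of `n`):
(i) `L̃_{2m}L̃_{2n} = L̃_{2n}L̃_{2m}` for `m, n ≥ 1`;
(ii) `L̄_{4k}` commutes with `L₁` for `k ≥ 1`, and
`L̄_{4k+2}L₁ - L₁L̄_{4k+2} = (1/2^{2k})([2k+1]_q/(2k+1))·M_{4k+3}` for `k ≥ 0`. -/
theorem stmt17 (q : ℂ) (hq0 : q ≠ 0) (hq : NotRootOfUnity q) (Lbar : ℕ → U q)
    (hLbar : ∀ n : ℕ, 1 ≤ n →
      θ q • Lt q (2*(n : ℤ))
        = ∑ c : Composition n,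
            ((θ q) ^ c.length / (Nat.factorial c.length : ℂ)) •
              (c.blocks.map (fun i => Lbar i)).prod) :
    (∀ m n : ℕ, 1 ≤ m → 1 ≤ n →
      Lt q (2*(m : ℤ)) * Lt q (2*(n : ℤ)) = Lt q (2*(n : ℤ)) * Lt q (2*(m : ℤ))) ∧
    (∀ k : ℕ, 1 ≤ k → Lbar (2*k) * L q 1 = L q 1 * Lbar (2*k)) ∧
    (∀ k : ℕ, Lbar (2*k+1) * L q 1 - L q 1 * Lbar (2*k+1)
      = (((2 : ℂ)^(2*k))⁻¹ * ((q^(2*k+1) - (q⁻¹)^(2*k+1)) / (q - q⁻¹)) / ((2*k+1 : ℕ) : ℂ))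
          • M q (2*k+1)) := by
  have g : AltData.Generic q := ⟨hq0, hq⟩
  have hθ := g.theta_ne
  have key := AltData.comm_log_L (d := altData hq0) g (a := Lbar) fun n hn => by
    rw [← Lt_two_mul]
    exact hLbar n hn
  refine ⟨fun m n _ _ => ?_, fun k hk => ?_, fun k => ?_⟩
  · rw [Lt_two_mul hq0, Lt_two_mul hq0]
    exact AltData.f_comm_f g m n
  · obtain ⟨k, rfl⟩ : ∃ m, k = m + 1 := ⟨k - 1, by omega⟩
    have h := key (2 * k + 1)
    rw [show 2 * k + 1 + 1 = 2 * (k + 1) by ring, AltData.logCoeff_even, zero_smul] at h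
    have hk : ((2 * (k + 1) : ℕ) : ℂ) ≠ 0 := Nat.cast_ne_zero.mpr (by omega)
    exact sub_eq_zero.mp ((smul_eq_zero.mp h).resolve_left (mul_ne_zero hθ hk))
  · have h := key (2 * k)
    rw [AltData.logCoeff_odd] at h
    have hk : ((2 * k + 1 : ℕ) : ℂ) ≠ 0 := Nat.cast_ne_zero.mpr (by omega)
    refine smul_right_injective _ (mul_ne_zero hθ hk) (h.trans ?_)
    change _ = (_ : ℂ) • _ • M q (2 * k + 1)
    rw [M_eq hq0 g, smul_smul, smul_smul]
    congr 1
    rw [pow_succ 2 (2 * k)]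
    generalize q ^ (2 * k + 1) - q⁻¹ ^ (2 * k + 1) = z
    generalize q - q⁻¹ = t at hθ ⊢
    field_simp
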